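/- arXiv:2207.03869 — 5 statements merged into one kernel-verified Lean document; each statement's English description precedes it below -/
import Mathlib

section
/- If G is a finite simple graph with maximum degree Δ that is (Δ+1)-list-edge-critical, then for every edge uv of G, deg(u) + deg(v) ≥ Δ + 3. -/
open scoped Classical

/-- A proper edge-coloring of `G` from the lists `L`: every edge receives a color
from its list, and distinct edges sharing a vertex receive distinct colors. -/
def IsProperListEdgeColoring {V : Type*} (G : SimpleGraph V)
    (L : Sym2 V → Finset ℕ) (f : Sym2 V → ℕ) : Prop :=
  (∀ e ∈ G.edgeSet, f e ∈ L e) ∧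
    ∀ e₁ ∈ G.edgeSet, ∀ e₂ ∈ G.edgeSet, e₁ ≠ e₂ → (∃ v, v ∈ e₁ ∧ v ∈ e₂) →
      f e₁ ≠ f e₂

/-- `G` is `k`-list-edge-colorable: for every edge-list-assignment `L` with all
lists of size at least `k`, `G` has a proper edge-coloring from the lists. -/
def ListEdgeColorable {V : Type*} (G : SimpleGraph V) (k : ℕ) : Prop :=
  ∀ L : Sym2 V → Finset ℕ, (∀ e ∈ G.edgeSet, k ≤ (L e).card) →
    ∃ f : Sym2 V → ℕ, IsProperListEdgeColoring G L f

/-- The list-chromatic index: the least `k` such that `G` is `k`-list-edge-colorable. -/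
noncomputable def listChromaticIndex {V : Type*} (G : SimpleGraph V) : ℕ :=
  sInf {k | ListEdgeColorable G k}

/-- `G` is `k`-list-edge-critical: `χ'ₗ(G) > k` and `χ'ₗ(G - e) ≤ k` for every edge `e`. -/
def ListEdgeCritical {V : Type*} (G : SimpleGraph V) (k : ℕ) : Prop :=
  k < listChromaticIndex G ∧
    ∀ e ∈ G.edgeSet, listChromaticIndex (G.deleteEdges {e}) ≤ k

/-- List-edge-colorability is monotone in the list size. -/
theorem ListEdgeColorable.mono {V : Type*} {G : SimpleGraph V} {k l : ℕ}
    (h : ListEdgeColorable G k) (hkl : k ≤ l) : ListEdgeColorable G l :=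
  fun L hL => h L fun e he => hkl.trans (hL e he)

/-- Lists at least as large as the number of pairs of vertices admit an injective choice. -/
theorem listEdgeColorable_card_sym2 {V : Type*} [Fintype V] (G : SimpleGraph V) :
    ListEdgeColorable G (Fintype.card (Sym2 V)) := by
  intro L hL
  let t : Sym2 V → Finset ℕ := fun e =>
    if e ∈ G.edgeSet then L e else Finset.range (Fintype.card (Sym2 V))
  have ht : ∀ e, Fintype.card (Sym2 V) ≤ (t e).card := by
    intro e
    by_cases he : e ∈ G.edgeSet
    · simpa [t, he] using hL e he
    · simp [t, he]
  obtain ⟨f, hf, hft⟩ :=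
    (Finset.all_card_le_biUnion_card_iff_exists_injective t).1 fun s => by
      obtain rfl | ⟨e, he⟩ := s.eq_empty_or_nonempty
      · simp
      · exact (Finset.card_le_univ s).trans
          ((ht e).trans (Finset.card_le_card (Finset.subset_biUnion_of_mem t he)))
  refine ⟨f, fun e he => by simpa [t, he] using hft e, ?_⟩
  exact fun e₁ _ e₂ _ hne _ h => hne (hf h)

/-- On a finite vertex set, the list-chromatic index is attained. -/
theorem listEdgeColorable_listChromaticIndex {V : Type*} [Fintype V] (G : SimpleGraph V) :
    ListEdgeColorable G (listChromaticIndex G) :=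
  Nat.sInf_mem (s := {k | ListEdgeColorable G k}) ⟨_, listEdgeColorable_card_sym2 G⟩

/-- If `G - uv` is `k`-list-edge-colorable and `uv` is adjacent to fewer than `k` edges, then
`G` is `k`-list-edge-colorable. -/
theorem ListEdgeColorable.of_deleteEdges {V : Type*} [Fintype V] {G : SimpleGraph V}
    [DecidableRel G.Adj] {k : ℕ} {u v : V} (huv : G.Adj u v)
    (hdeg : G.degree u + G.degree v < k + 2)
    (h : ListEdgeColorable (G.deleteEdges {s(u, v)}) k) : ListEdgeColorable G k := by
  intro L hL
  have hmem : ∀ e, e ∈ (G.deleteEdges {s(u, v)}).edgeSet ↔ e ∈ G.edgeSet ∧ e ≠ s(u, v) := by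
    simp [SimpleGraph.edgeSet_deleteEdges]
  obtain ⟨f, hfL, hf⟩ := h L fun e he => hL e ((hmem e).1 he).1
  let A : Finset (Sym2 V) :=
    (G.incidenceFinset u).erase s(u, v) ∪ (G.incidenceFinset v).erase s(u, v)
  have hA : A.card < k := by
    have h₁ : s(u, v) ∈ G.incidenceFinset u := by
      simpa [SimpleGraph.mem_incidenceFinset, SimpleGraph.incidenceSet] using huv
    have h₂ : s(u, v) ∈ G.incidenceFinset v := by
      simpa [SimpleGraph.mem_incidenceFinset, SimpleGraph.incidenceSet] using huv
    have c₁ := Finset.card_erase_add_one h₁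
    have c₂ := Finset.card_erase_add_one h₂
    rw [SimpleGraph.card_incidenceFinset_eq_degree] at c₁ c₂
    have c₃ : A.card ≤ _ := Finset.card_union_le _ _
    omega
  obtain ⟨c, hcL, hc⟩ : ∃ c ∈ L s(u, v), c ∉ A.image f :=
    Finset.exists_mem_notMem_of_card_lt_card
      ((Finset.card_image_le.trans_lt hA).trans_le (hL _ huv))
  have hnew : ∀ e ∈ G.edgeSet, e ≠ s(u, v) → (∃ w, w ∈ s(u, v) ∧ w ∈ e) → f e ≠ c := by
    rintro e he hne ⟨w, hw, hwe⟩ rfl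
    refine hc (Finset.mem_image_of_mem f ?_)
    rcases Sym2.mem_iff.1 hw with rfl | rfl <;>
      simp [A, SimpleGraph.mem_incidenceFinset, SimpleGraph.incidenceSet, he, hne, hwe]
  refine ⟨Function.update f s(u, v) c, fun e he => ?_, fun e₁ h₁ e₂ h₂ hne hw => ?_⟩
  · by_cases heq : e = s(u, v)
    · simpa [heq] using hcL
    · simpa [heq] using hfL e ((hmem e).2 ⟨he, heq⟩)
  · by_cases heq₁ : e₁ = s(u, v)
    · subst heq₁
      simpa [hne.symm] using (hnew e₂ h₂ hne.symm hw).symm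
    · by_cases heq₂ : e₂ = s(u, v)
      · subst heq₂
        simpa [hne] using hnew e₁ h₁ hne (hw.imp fun _ h => h.symm)
      · simpa [heq₁, heq₂] using
          hf e₁ ((hmem e₁).2 ⟨h₁, heq₁⟩) e₂ ((hmem e₂).2 ⟨h₂, heq₂⟩) hne hw

theorem stmt_0 {V : Type*} [Fintype V] (G : SimpleGraph V) [DecidableRel G.Adj]
    (Δ : ℕ) (hΔ : G.maxDegree = Δ)
    (hcrit : ListEdgeCritical G (Δ + 1)) :
    ∀ u v : V, G.Adj u v → Δ + 3 ≤ G.degree u + G.degree v := by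
  intro u v huv
  by_contra! hlt
  have hdel := (listEdgeColorable_listChromaticIndex _).mono (hcrit.2 s(u, v) huv)
  exact hcrit.1.not_ge (Nat.sInf_le (hdel.of_deleteEdges huv hlt))
end

section
/- If G is a finite simple graph with maximum degree Δ ≥ 4 that is (Δ+1)-list-edge-critical, then 2·|V₃| < |V_Δ|. -/
open scoped Classical

/-- A graph with finitely many edges can be colored from lists as long as its number of edges. -/
theorem exists_listEdgeColorable {V : Type*} [Fintype V] (G : SimpleGraph V) :
    ∃ k, ListEdgeColorable G k := by
  refine ⟨Fintype.card G.edgeSet, fun L hL => ?_⟩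
  obtain ⟨g, hinj, hg⟩ := (Finset.all_card_le_biUnion_card_iff_exists_injective
    (fun e : G.edgeSet => L e)).1 (by
      intro s
      rcases s.eq_empty_or_nonempty with rfl | ⟨e, he⟩
      · simp
      · exact (Finset.card_le_univ s).trans ((hL e e.2).trans
          (Finset.card_le_card (Finset.subset_biUnion_of_mem (fun e : G.edgeSet => L e) he))))
  refine ⟨fun e => if he : e ∈ G.edgeSet then g ⟨e, he⟩ else 0, fun e he => ?_, ?_⟩
  · simpa [he] using hg ⟨e, he⟩
  · intro e₁ h₁ e₂ h₂ hne _
    simp only [h₁, h₂, dite_true]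
    exact fun h => hne (congrArg Subtype.val (hinj h))

theorem ListEdgeColorable.anti {V : Type*} {G H : SimpleGraph V} {k : ℕ}
    (h : ListEdgeColorable G k) (hHG : H ≤ G) : ListEdgeColorable H k := by
  intro L hL
  obtain ⟨f, hf, hp⟩ := h (fun e => if e ∈ H.edgeSet then L e else Finset.range k) (by
    intro e _
    split_ifs with he
    · exact hL e he
    · simp)
  have hsub := SimpleGraph.edgeSet_mono hHG
  refine ⟨f, fun e he => ?_, fun e₁ h₁ e₂ h₂ => hp e₁ (hsub h₁) e₂ (hsub h₂)⟩
  simpa [he] using hf e (hsub he)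

theorem listEdgeColorable_of_listChromaticIndex_le {V : Type*} [Fintype V] {G : SimpleGraph V}
    {k : ℕ} (h : listChromaticIndex G ≤ k) : ListEdgeColorable G k :=
  ListEdgeColorable.mono (Nat.sInf_mem (s := {k | ListEdgeColorable G k})
    (exists_listEdgeColorable G)) h

theorem not_listEdgeColorable_of_lt_listChromaticIndex {V : Type*} {G : SimpleGraph V}
    {k : ℕ} (h : k < listChromaticIndex G) : ¬ ListEdgeColorable G k :=
  fun hc => absurd (Nat.sInf_le hc) (not_le.2 h)

/-- In a critical graph, every nonempty set `F` of edges carries lists, large in terms of the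
degrees, from which `F` cannot be properly colored: the colors left over by a coloring of the
other edges. -/
theorem ListEdgeCritical.exists_residual_lists {V : Type*} [Fintype V] {G : SimpleGraph V}
    [DecidableRel G.Adj] {k : ℕ} (hcrit : ListEdgeCritical G k) {F : Set (Sym2 V)}
    (hF : F ⊆ G.edgeSet) (hne : F.Nonempty) :
    ∃ M : Sym2 V → Finset ℕ,
      (∀ u v, s(u, v) ∈ F → ∀ A B : Finset V, (∀ w ∈ A, s(u, w) ∈ F) → (∀ w ∈ B, s(v, w) ∈ F) →
        k + A.card + B.card ≤ (M s(u, v)).card + G.degree u + G.degree v) ∧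
      ¬ ∃ g : Sym2 V → ℕ, (∀ e ∈ F, g e ∈ M e) ∧
        ∀ e₁ ∈ F, ∀ e₂ ∈ F, e₁ ≠ e₂ → (∃ v, v ∈ e₁ ∧ v ∈ e₂) → g e₁ ≠ g e₂ := by
  have hbad := not_listEdgeColorable_of_lt_listChromaticIndex hcrit.1
  unfold ListEdgeColorable at hbad
  push Not at hbad
  obtain ⟨L, hL, hno⟩ := hbad
  obtain ⟨e₀, he₀⟩ := hne
  have hcol : ListEdgeColorable (G.deleteEdges F) k :=
    (listEdgeColorable_of_listChromaticIndex_le (hcrit.2 e₀ (hF he₀))).anti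
      (SimpleGraph.deleteEdges_anti (Set.singleton_subset_iff.2 he₀))
  have hmem : ∀ e, e ∈ (G.deleteEdges F).edgeSet ↔ e ∈ G.edgeSet ∧ e ∉ F := by
    intro e; rw [SimpleGraph.edgeSet_deleteEdges]; rfl
  obtain ⟨f, hf, hfp⟩ := hcol L fun e he => hL e ((hmem e).1 he).1
  let N : V → Finset V := fun u => (G.neighborFinset u).filter fun w => s(u, w) ∉ F
  let C : V → Finset ℕ := fun u => (N u).image fun w => f s(u, w)
  have hN : ∀ u, ∀ A : Finset V, (∀ w ∈ A, s(u, w) ∈ F) → (C u).card + A.card ≤ G.degree u := by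
    intro u A hA
    have h1 : (C u).card ≤ (N u).card := Finset.card_image_le
    have h2 : A ⊆ (G.neighborFinset u).filter fun w => s(u, w) ∈ F := by
      intro w hw
      rw [Finset.mem_filter, SimpleGraph.mem_neighborFinset]
      exact ⟨hF (hA w hw), hA w hw⟩
    have h4 := Finset.card_le_card h2
    have h3 := Finset.card_filter_add_card_filter_not (s := G.neighborFinset u)
      (fun w => s(u, w) ∈ F)
    rw [← SimpleGraph.card_neighborFinset_eq_degree]
    change _ + (N u).card = _ at h3
    omega
  let M : Sym2 V → Finset ℕ := fun e => (L e).filter fun c => ∀ u ∈ e, c ∉ C u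
  refine ⟨M, ?_, ?_⟩
  · intro u v huv A B hA hB
    have h1 : L s(u, v) ⊆ M s(u, v) ∪ (C u ∪ C v) := by
      intro c hc
      by_cases hu : c ∈ C u
      · simp [hu]
      by_cases hv : c ∈ C v
      · simp [hv]
      have : c ∈ M s(u, v) := by simp [M, hc, hu, hv]
      simp [this]
    have h2 := Finset.card_le_card h1
    have h3 := Finset.card_union_le (M s(u, v)) (C u ∪ C v)
    have h4 := Finset.card_union_le (C u) (C v)
    have h5 := hL _ (hF huv)
    have h6 := hN u A hA
    have h7 := hN v B hB
    omega
  · rintro ⟨g, hg, hgp⟩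
    have hcross : ∀ e₁ ∈ F, ∀ e₂ ∈ G.edgeSet, e₂ ∉ F → (∃ v, v ∈ e₁ ∧ v ∈ e₂) →
        g e₁ ≠ f e₂ := by
      rintro e₁ h₁ e₂ h₂ h₂F ⟨v, hv₁, hv₂⟩ heq
      obtain ⟨w, rfl⟩ := hv₂
      refine (Finset.mem_filter.1 (hg e₁ h₁)).2 v hv₁ ?_
      rw [heq]
      refine Finset.mem_image.2 ⟨w, ?_, rfl⟩
      simp only [N, Finset.mem_filter, SimpleGraph.mem_neighborFinset]
      exact ⟨h₂, h₂F⟩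
    refine hno (fun e => if e ∈ F then g e else f e) ⟨fun e he => ?_, ?_⟩
    · by_cases heF : e ∈ F
      · simpa [heF] using (Finset.mem_filter.1 (hg e heF)).1
      · simpa [heF] using hf e ((hmem e).2 ⟨he, heF⟩)
    · intro e₁ h₁ e₂ h₂ hne hs
      by_cases h₁F : e₁ ∈ F <;> by_cases h₂F : e₂ ∈ F <;> simp only [h₁F, h₂F, if_true, if_false]
      · exact hgp e₁ h₁F e₂ h₂F hne hs
      · exact hcross e₁ h₁F e₂ h₂ h₂F hs
      · obtain ⟨v, hv⟩ := hs
        exact (hcross e₂ h₂F e₁ h₁ h₁F ⟨v, hv.symm⟩).symm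
      · exact hfp e₁ ((hmem _).2 ⟨h₁, h₁F⟩) e₂ ((hmem _).2 ⟨h₂, h₂F⟩) hne hs

/-- The two ends of an edge of a `k`-critical graph have degree sum at least `k + 2`. -/
theorem ListEdgeCritical.add_two_le_degree_add_degree {V : Type*} [Fintype V] {G : SimpleGraph V}
    [DecidableRel G.Adj] {k : ℕ} (hcrit : ListEdgeCritical G k) {u v : V} (huv : G.Adj u v) :
    k + 2 ≤ G.degree u + G.degree v := by
  obtain ⟨M, hM, hno⟩ := hcrit.exists_residual_lists (F := {s(u, v)})
    (Set.singleton_subset_iff.2 huv) (Set.singleton_nonempty _)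
  have h := hM u v rfl {v} {u} (by simp) (by simp)
  simp only [Finset.card_singleton] at h
  by_contra! hlt
  obtain ⟨c, hc⟩ := Finset.card_pos.1 (show 0 < (M s(u, v)).card by omega)
  refine hno ⟨fun _ => c, ?_, ?_⟩
  · rintro e rfl
    exact hc
  · rintro e₁ rfl e₂ rfl hne
    exact absurd rfl hne

/-- The edges of a cycle whose vertices alternate in the property `p` can be properly colored
from lists of size two. -/
theorem exists_cyclic_list_coloring {m : ℕ} (L : Fin (m + 3) → Finset ℕ)
    (hL : ∀ i, 2 ≤ (L i).card) (p : Fin (m + 3) → Prop) (hp : ∀ i, p i ↔ ¬ p (i + 1)) :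
    ∃ h : Fin (m + 3) → ℕ, ∀ i, h i ∈ L i ∧ h i ≠ h (i + 1) := by
  choose K hKL hK using fun i => Finset.exists_subset_card_eq (hL i)
  by_cases hconst : ∀ i, K i = K (i + 1)
  · have hall : ∀ i, K i = K 0 := by
      intro i
      induction i using Fin.induction with
      | zero => rfl
      | succ i ih => rw [← ih, hconst i.castSucc, Fin.coeSucc_eq_succ]
    obtain ⟨a, b, hab, h0⟩ := Finset.card_eq_two.1 (hK 0)
    refine ⟨fun i => if p i then a else b, fun i => ⟨hKL i ?_, ?_⟩⟩
    · rw [hall, h0]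
      dsimp only
      split_ifs <;> simp
    · by_cases hi : p i
      · simpa [hi, (hp i).1 hi] using hab
      · have : p (i + 1) := by by_contra h; exact hi ((hp i).2 h)
        simpa [hi, this] using hab.symm
  · push Not at hconst
    obtain ⟨j, hj⟩ := hconst
    obtain ⟨a, ha, haj⟩ : ∃ a ∈ K (j + 1), a ∉ K j := by
      by_contra! h
      exact hj (Finset.eq_of_subset_of_card_le h (by rw [hK, hK])).symm
    have hex : ∀ i c, ∃ d ∈ K i, d ≠ c := fun i c =>
      Finset.exists_mem_ne (by rw [hK]; norm_num) c
    choose d hdK hdc using hex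
    let g : ℕ → ℕ := fun t => Nat.rec a (fun t c => d (j + 1 + Fin.ofNat (m + 3) (t + 1)) c) t
    have hg : ∀ t : ℕ, g t ∈ K (j + 1 + Fin.ofNat (m + 3) t) := by
      rintro (_ | t)
      · simpa [g] using ha
      · exact hdK _ _
    have hsucc : ∀ t, g (t + 1) ≠ g t := fun t => hdc _ _
    have hmem : ∀ i, g (i - (j + 1)).val ∈ K i := by
      intro i
      simpa using hg (i - (j + 1)).val
    refine ⟨fun i => g (i - (j + 1)).val, fun i => ⟨hKL i (hmem i), ?_⟩⟩
    by_cases hij : i = j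
    · subst hij
      intro h
      apply haj
      have := hmem i
      dsimp only at h
      rw [h] at this
      simpa [g] using this
    · have hlast : i - (j + 1) ≠ Fin.last (m + 2) := by
        intro h
        apply hij
        have h1 : i - (j + 1) + 1 = 0 := by rw [h, Fin.last_add_one]
        have h2 : i - j = 0 := by rw [← h1]; abel
        exact sub_eq_zero.1 h2
      have hval : (i + 1 - (j + 1)).val = (i - (j + 1)).val + 1 := by
        rw [show i + 1 - (j + 1) = i - (j + 1) + 1 by abel]
        exact Fin.val_add_one_of_lt (lt_of_le_of_ne (Fin.le_last _) hlast)
      dsimp only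
      rw [hval]
      exact (hsucc _).symm

/-- A critical graph has no cycle whose vertices alternate in the property `p` and whose edges all
have small degree sum. -/
theorem ListEdgeCritical.not_exists_alternating_cycle {V : Type*} [Fintype V] {G : SimpleGraph V}
    [DecidableRel G.Adj] {k : ℕ} (hcrit : ListEdgeCritical G k) {m : ℕ} (φ : Fin (m + 3) → V)
    (hφ : Function.Injective φ) (hadj : ∀ i, G.Adj (φ i) (φ (i + 1)))
    (hdeg : ∀ i, G.degree (φ i) + G.degree (φ (i + 1)) ≤ k + 2)
    (p : V → Prop) (hp : ∀ i, p (φ i) ↔ ¬ p (φ (i + 1))) : False := by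
  have htwo : ∀ i : Fin (m + 3), i + 1 + 1 ≠ i := by
    intro i h
    have h1 : (1 + 1 : Fin (m + 3)) = 0 := by
      have : i + (1 + 1) = i := by rw [← add_assoc, h]
      simpa using this
    have h2 := congrArg Fin.val h1
    rw [Fin.val_add, Fin.val_one, Fin.val_zero, Nat.mod_eq_of_lt (by omega)] at h2
    omega
  let e : Fin (m + 3) → Sym2 V := fun i => s(φ i, φ (i + 1))
  have he : Function.Injective e := by
    intro i j hij
    rcases Sym2.eq_iff.1 hij with ⟨h, _⟩ | ⟨h₁, h₂⟩
    · exact hφ h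
    · exact absurd (by rw [← hφ h₁]; exact hφ h₂) (htwo j)
  obtain ⟨M, hM, hno⟩ := hcrit.exists_residual_lists (F := Set.range e)
    (by rintro _ ⟨i, rfl⟩; exact hadj i) ⟨e 0, 0, rfl⟩
  have hnbrs : ∀ i, ∃ A : Finset V, A.card = 2 ∧ ∀ w ∈ A, s(φ i, w) ∈ Set.range e := by
    intro i
    refine ⟨{φ (i + 1), φ (i - 1)}, Finset.card_pair fun h => ?_, fun w hw => ?_⟩
    · exact htwo (i - 1) (by simpa using hφ h)
    · rcases Finset.mem_insert.1 hw with rfl | hw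
      · exact ⟨i, rfl⟩
      · rw [Finset.mem_singleton.1 hw]
        exact ⟨i - 1, by simp [e, Sym2.eq_swap]⟩
  obtain ⟨h, hh⟩ := exists_cyclic_list_coloring (fun i => M (e i)) (fun i => by
    obtain ⟨A, h2, hA⟩ := hnbrs i
    obtain ⟨B, h3, hB⟩ := hnbrs (i + 1)
    have h1 := hM (φ i) (φ (i + 1)) ⟨i, rfl⟩ A B hA hB
    have h4 := hdeg i
    change 2 ≤ (M s(φ i, φ (i + 1))).card
    omega) (fun i => p (φ i)) hp
  refine hno ⟨Function.extend e h 0, ?_, ?_⟩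
  · rintro _ ⟨i, rfl⟩
    rw [he.extend_apply]
    exact (hh i).1
  · rintro _ ⟨i, rfl⟩ _ ⟨j, rfl⟩ hne ⟨v, hvi, hvj⟩
    rw [he.extend_apply, he.extend_apply]
    have hij : i ≠ j := fun h => hne (congrArg e h)
    rcases Sym2.mem_iff.1 hvi with rfl | rfl <;> rcases Sym2.mem_iff.1 hvj with h' | h'
    · exact absurd (hφ h') hij
    · rw [hφ h']; exact (hh j).2.symm
    · rw [← hφ h']; exact (hh i).2
    · exact absurd (add_right_cancel (hφ h')) hij

/-- A forest has fewer edges than vertices. -/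
theorem SimpleGraph.IsAcyclic.card_edgeFinset_lt {V : Type*} [Fintype V] [Nonempty V]
    {G : SimpleGraph V} [Fintype G.edgeSet] (h : G.IsAcyclic) :
    G.edgeFinset.card < Fintype.card V := by
  obtain ⟨T, hGT, -, hT⟩ :=
    (SimpleGraph.connected_top (V := V)).exists_isTree_le_of_le_of_isAcyclic le_top h
  have h1 := hT.card_edgeFinset
  have h2 := Finset.card_le_card (SimpleGraph.edgeFinset_mono hGT)
  omega

theorem stmt_3 {V : Type*} [Fintype V] (G : SimpleGraph V) [DecidableRel G.Adj]
    (Δ : ℕ) (hΔ : G.maxDegree = Δ) (hΔ4 : 4 ≤ Δ)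
    (hcrit : ListEdgeCritical G (Δ + 1)) :
    2 * (Finset.univ.filter fun v : V => G.degree v = 3).card <
      (Finset.univ.filter fun v : V => G.degree v = Δ).card := by
  let S := {v : V // G.degree v = 3 ∨ G.degree v = Δ}
  have hnbr : ∀ u v, G.degree u = 3 → G.Adj u v → G.degree v = Δ := by
    intro u v hu huv
    have h1 := hcrit.add_two_le_degree_add_degree huv
    have h2 := G.degree_le_maxDegree v
    omega
  let B : SimpleGraph S :=
    { Adj := fun u v => G.Adj u v ∧ (G.degree u.1 = 3 ↔ ¬ G.degree v.1 = 3)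
      symm := ⟨fun u v h => ⟨h.1.symm, by tauto⟩⟩
      loopless := ⟨fun u h => G.loopless.irrefl _ h.1⟩ }
  have hacyc : B.IsAcyclic := by
    rw [SimpleGraph.isAcyclic_iff_free_cycleGraph]
    rintro n hn ⟨φ⟩
    obtain ⟨m, rfl⟩ : ∃ m, n = m + 3 := ⟨n - 3, by omega⟩
    have hB : ∀ i, B.Adj (φ i) (φ (i + 1)) := fun i =>
      φ.toHom.map_adj (SimpleGraph.cycleGraph_adj.2 (Or.inr (by simp)))
    refine hcrit.not_exists_alternating_cycle (fun i => (φ i).1)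
      (Subtype.val_injective.comp φ.injective) (fun i => (hB i).1) (fun i => ?_)
      (fun v => G.degree v = 3) (fun i => (hB i).2)
    have h1 := (hB i).2
    have h2 := (φ i).2
    have h3 := (φ (i + 1)).2
    by_cases h : G.degree (φ i).1 = 3
    · have := h1.1 h
      omega
    · have : G.degree (φ (i + 1)).1 = 3 := by tauto
      omega
  have : Nonempty V := by
    by_contra h
    rw [not_nonempty_iff] at h
    have := G.maxDegree_of_subsingleton
    omega
  obtain ⟨v₀, hv₀⟩ := G.exists_maximal_degree_vertex
  have : Nonempty S := ⟨⟨v₀, Or.inr (by omega)⟩⟩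
  have hlt := hacyc.card_edgeFinset_lt
  have hbip : B.IsBipartiteWith
      ((Finset.univ.filter fun v : S => G.degree v.1 = 3 : Finset S) : Set S)
      ((Finset.univ.filter fun v : S => ¬ G.degree v.1 = 3 : Finset S) : Set S) := by
    refine ⟨Finset.disjoint_coe.2 (Finset.disjoint_filter_filter_not _ _ _), fun u v h => ?_⟩
    simp only [Finset.coe_filter, Finset.mem_univ, true_and, Set.mem_ofPred_eq]
    have := h.2
    tauto
  have hsum := SimpleGraph.isBipartiteWith_sum_degrees_eq_card_edges hbip
  have hdeg : ∀ u ∈ (Finset.univ.filter fun v : S => G.degree v.1 = 3), B.degree u = 3 := by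
    intro u hu
    have hu3 : G.degree u.1 = 3 := (Finset.mem_filter.1 hu).2
    refine Eq.trans ?_ hu3
    rw [← SimpleGraph.card_neighborFinset_eq_degree, ← SimpleGraph.card_neighborFinset_eq_degree]
    refine Finset.card_bij (fun w _ => w.1) ?_ (fun _ _ _ _ h => Subtype.ext h) ?_
    · intro w hw
      rw [SimpleGraph.mem_neighborFinset] at hw ⊢
      exact hw.1
    · intro w hw
      rw [SimpleGraph.mem_neighborFinset] at hw
      have hwΔ := hnbr _ _ hu3 hw
      refine ⟨⟨w, Or.inr hwΔ⟩, ?_, rfl⟩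
      rw [SimpleGraph.mem_neighborFinset]
      exact ⟨hw, iff_of_true hu3 (by dsimp only; omega)⟩
  rw [Finset.sum_congr rfl hdeg, Finset.sum_const, smul_eq_mul] at hsum
  have hcard3 : (Finset.univ.filter fun v : S => G.degree v.1 = 3).card
      = (Finset.univ.filter fun v : V => G.degree v = 3).card := by
    refine Finset.card_bij (fun w _ => w.1) (by simp) (fun _ _ _ _ h => Subtype.ext h) ?_
    intro w hw
    have hw3 := (Finset.mem_filter.1 hw).2
    exact ⟨⟨w, Or.inl hw3⟩, by simpa using hw3, rfl⟩
  have hcardS : Fintype.card S ≤ (Finset.univ.filter fun v : V => G.degree v = 3).card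
      + (Finset.univ.filter fun v : V => G.degree v = Δ).card := by
    rw [Fintype.card_subtype, Finset.filter_or]
    exact Finset.card_union_le _ _
  omega
end

section
/- If G is a finite simple graph with maximum degree Δ ≤ 9 and mad(G) < (Δ + 3)/2, then χ'_ℓ(G) ≤ Δ + 1. -/
open scoped Classical

/-- `mad(G) < m`: every nonempty subgraph `H` of `G` has average degree less than `m`. -/
def MadLT {V : Type*} [Fintype V] (G : SimpleGraph V) (m : ℝ) : Prop :=
  ∀ H : G.Subgraph, H.verts.Nonempty →
    (∑ v ∈ H.verts.toFinset, ((H.neighborSet v).ncard : ℝ)) / (H.verts.toFinset.card : ℝ) < m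

/-- A finite set of pairs, with a linear preference `p` on each row and `q` on each column,
contains a stable matching. -/
lemma exists_stable_matching {α β : Type*} (p q : α × β → ℕ) (T : Finset (α × β))
    (hp : ∀ e ∈ T, ∀ e' ∈ T, e.1 = e'.1 → p e = p e' → e = e')
    (hq : ∀ e ∈ T, ∀ e' ∈ T, e.2 = e'.2 → q e = q e' → e = e') :
    ∃ K ⊆ T, (∀ e ∈ K, ∀ e' ∈ K, e.1 = e'.1 ∨ e.2 = e'.2 → e = e') ∧
      ∀ e ∈ T, e ∉ K → ∃ k ∈ K, (k.1 = e.1 ∧ p e < p k) ∨ (k.2 = e.2 ∧ q e < q k) := by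
  induction T using Finset.strongInduction with
  | H T ih =>
  set A := T.filter (fun e => ∀ e' ∈ T, e'.1 = e.1 → p e' ≤ p e) with hA
  by_cases hinj : ∀ e ∈ A, ∀ e' ∈ A, e.2 = e'.2 → e = e'
  · refine ⟨A, Finset.filter_subset _ _, ?_, ?_⟩
    · rintro e he e' he' (h | h)
      · simp only [hA, Finset.mem_filter] at he he'
        exact hp e he.1 e' he'.1 h (le_antisymm (he'.2 e he.1 h) (he.2 e' he'.1 h.symm))
      · exact hinj e he e' he' h
    · intro e he heA
      obtain ⟨k, hk, hmax⟩ := Finset.exists_max_image (T.filter (fun e' => e'.1 = e.1)) p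
        ⟨e, by simp [he]⟩
      simp only [Finset.mem_filter] at hk hmax
      have hkA : k ∈ A := by
        simp only [hA, Finset.mem_filter]
        exact ⟨hk.1, fun e' he' h => hmax e' ⟨he', h.trans hk.2⟩⟩
      refine ⟨k, hkA, Or.inl ⟨hk.2, ?_⟩⟩
      refine lt_of_le_of_ne (hmax e ⟨he, rfl⟩) fun h => heA ?_
      rwa [hp e he k hk.1 hk.2.symm h]
  · push Not at hinj
    obtain ⟨e₁, h₁, e₂, h₂, hb, hne, hlt⟩ :
        ∃ e₁ ∈ A, ∃ e₂ ∈ A, e₁.2 = e₂.2 ∧ e₁ ≠ e₂ ∧ q e₁ < q e₂ := by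
      obtain ⟨e₁, h₁, e₂, h₂, hb, hne⟩ := hinj
      have hT₁ := (Finset.mem_filter.1 h₁).1
      have hT₂ := (Finset.mem_filter.1 h₂).1
      rcases lt_trichotomy (q e₁) (q e₂) with h | h | h
      · exact ⟨e₁, h₁, e₂, h₂, hb, hne, h⟩
      · exact absurd (hq e₁ hT₁ e₂ hT₂ hb h) hne
      · exact ⟨e₂, h₂, e₁, h₁, hb.symm, hne.symm, h⟩
    simp only [hA, Finset.mem_filter] at h₁ h₂
    obtain ⟨K, hKT, hK, hdom⟩ := ih (T.erase e₁) (Finset.erase_ssubset h₁.1)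
      (fun e he e' he' => hp e (Finset.mem_of_mem_erase he) e' (Finset.mem_of_mem_erase he'))
      (fun e he e' he' => hq e (Finset.mem_of_mem_erase he) e' (Finset.mem_of_mem_erase he'))
    refine ⟨K, hKT.trans (Finset.erase_subset _ _), hK, fun e he heK => ?_⟩
    by_cases hee : e = e₁
    · subst hee
      by_cases h₂K : e₂ ∈ K
      · exact ⟨e₂, h₂K, Or.inr ⟨hb.symm, hlt⟩⟩
      · obtain ⟨k, hk, h | h⟩ := hdom e₂ (Finset.mem_erase.2 ⟨hne.symm, h₂.1⟩) h₂K
        · have := h₂.2 k (Finset.mem_of_mem_erase (hKT hk)) h.1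
          omega
        · exact ⟨k, hk, Or.inr ⟨h.1.trans hb.symm, hlt.trans h.2⟩⟩
    · exact hdom e (Finset.mem_erase.2 ⟨hee, he⟩) heK

/-- Galvin's kernel method: a bipartite graph can be edge-colored from its lists when each list is
larger than the number of adjacent edges preferred to the edge. -/
lemma exists_list_coloring_of_preferences {α β : Type*} (p q : α × β → ℕ) (S : Finset (α × β))
    (hp : ∀ e ∈ S, ∀ e' ∈ S, e.1 = e'.1 → p e = p e' → e = e')
    (hq : ∀ e ∈ S, ∀ e' ∈ S, e.2 = e'.2 → q e = q e' → e = e')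
    (L : α × β → Finset ℕ)
    (hL : ∀ e ∈ S, (S.filter (fun e' => e'.1 = e.1 ∧ p e < p e')).card +
      (S.filter (fun e' => e'.2 = e.2 ∧ q e < q e')).card < (L e).card) :
    ∃ c : α × β → ℕ, (∀ e ∈ S, c e ∈ L e) ∧
      ∀ e ∈ S, ∀ e' ∈ S, e ≠ e' → e.1 = e'.1 ∨ e.2 = e'.2 → c e ≠ c e' := by
  induction S using Finset.strongInduction generalizing L with
  | H S ih =>
  rcases S.eq_empty_or_nonempty with rfl | ⟨e₀, he₀⟩
  · exact ⟨fun _ => 0, by simp, by simp⟩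
  obtain ⟨a, ha⟩ : (L e₀).Nonempty := Finset.card_pos.1 (by have := hL e₀ he₀; omega)
  set T := S.filter (fun e => a ∈ L e) with hT
  have hTS : T ⊆ S := Finset.filter_subset _ _
  obtain ⟨K, hKT, hK, hdom⟩ := exists_stable_matching p q T
    (fun e he e' he' => hp e (hTS he) e' (hTS he'))
    (fun e he e' he' => hq e (hTS he) e' (hTS he'))
  have hKS := hKT.trans hTS
  have hKne : K.Nonempty := by
    by_cases h : e₀ ∈ K
    · exact ⟨e₀, h⟩
    · obtain ⟨k, hk, -⟩ := hdom e₀ (by simp [hT, he₀, ha]) h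
      exact ⟨k, hk⟩
  have hsub : S \ K ⊆ S := Finset.sdiff_subset
  obtain ⟨c, hc, hc'⟩ := ih (S \ K) (Finset.sdiff_ssubset hKS hKne)
    (fun e he e' he' => hp e (hsub he) e' (hsub he'))
    (fun e he e' he' => hq e (hsub he) e' (hsub he'))
    (fun e => (L e).erase a) (by
      intro e he
      have heS := hsub he
      have heK := (Finset.mem_sdiff.1 he).2
      have h1 := Finset.card_le_card (Finset.filter_subset_filter
        (fun e' => e'.1 = e.1 ∧ p e < p e') hsub)
      have h2 := Finset.card_le_card (Finset.filter_subset_filter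
        (fun e' => e'.2 = e.2 ∧ q e < q e') hsub)
      have h3 := hL e heS
      by_cases hae : a ∈ L e
      · rw [Finset.card_erase_of_mem hae]
        obtain ⟨k, hk, h | h⟩ := hdom e (by simp [hT, heS, hae]) heK
        · have : ((S \ K).filter (fun e' => e'.1 = e.1 ∧ p e < p e')).card <
              (S.filter (fun e' => e'.1 = e.1 ∧ p e < p e')).card :=
            Finset.card_lt_card (Finset.ssubset_iff_subset_ne.2
              ⟨Finset.filter_subset_filter _ hsub, fun heq => by
                have : k ∈ S.filter (fun e' => e'.1 = e.1 ∧ p e < p e') := by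
                  simp [hKS hk, h]
                rw [← heq] at this
                simp [hk] at this⟩)
          omega
        · have : ((S \ K).filter (fun e' => e'.2 = e.2 ∧ q e < q e')).card <
              (S.filter (fun e' => e'.2 = e.2 ∧ q e < q e')).card :=
            Finset.card_lt_card (Finset.ssubset_iff_subset_ne.2
              ⟨Finset.filter_subset_filter _ hsub, fun heq => by
                have : k ∈ S.filter (fun e' => e'.2 = e.2 ∧ q e < q e') := by
                  simp [hKS hk, h]
                rw [← heq] at this
                simp [hk] at this⟩)
          omega
      · rw [Finset.erase_eq_of_notMem hae]
        omega)
  refine ⟨fun e => if e ∈ K then a else c e, fun e he => ?_, fun e he e' he' hne hadj => ?_⟩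
  · by_cases h : e ∈ K
    · simpa [h] using (Finset.mem_filter.1 (hKT h)).2
    · simpa [h] using Finset.mem_of_mem_erase (hc e (Finset.mem_sdiff.2 ⟨he, h⟩))
  · by_cases h : e ∈ K <;> by_cases h' : e' ∈ K
    · exact absurd (hK e h e' h' hadj) hne
    · simpa [h, h'] using (Finset.ne_of_mem_erase (hc e' (Finset.mem_sdiff.2 ⟨he', h'⟩))).symm
    · simpa [h, h'] using Finset.ne_of_mem_erase (hc e (Finset.mem_sdiff.2 ⟨he, h⟩))
    · simpa [h, h'] using hc' e (Finset.mem_sdiff.2 ⟨he, h⟩) e' (Finset.mem_sdiff.2 ⟨he', h'⟩)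
        hne hadj

/-- In a minimum vertex cover, the covering vertices of one part can be matched into the
non-covering vertices of the other part. -/
lemma exists_matching_of_min_cover {α β : Type*} (H : Finset (α × β)) (A : Finset α) (B : Finset β)
    (hcov : ∀ e ∈ H, e.1 ∈ A ∨ e.2 ∈ B)
    (hmin : ∀ (A' : Finset α) (B' : Finset β), (∀ e ∈ H, e.1 ∈ A' ∨ e.2 ∈ B') →
      A.card + B.card ≤ A'.card + B'.card) :
    ∃ f : A → β, Function.Injective f ∧ ∀ x, (x.1, f x) ∈ H ∧ f x ∉ B := by
  obtain ⟨f, hf, hf'⟩ := (Finset.all_card_le_biUnion_card_iff_exists_injective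
    (fun x : A => (H.filter (fun e => e.1 = x.1 ∧ e.2 ∉ B)).image Prod.snd)).1 (by
      intro s
      set N := s.biUnion (fun x : A => (H.filter (fun e => e.1 = x.1 ∧ e.2 ∉ B)).image Prod.snd)
        with hN
      have h := hmin (A \ s.image Subtype.val) (B ∪ N) (by
        intro e he
        by_cases hB : e.2 ∈ B
        · exact Or.inr (Finset.mem_union_left _ hB)
        have hA := (hcov e he).resolve_right hB
        by_cases hs : (⟨e.1, hA⟩ : A) ∈ s
        · refine Or.inr (Finset.mem_union_right _ ?_)
          rw [hN, Finset.mem_biUnion]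
          exact ⟨_, hs, Finset.mem_image.2 ⟨e, by simp [he, hB], rfl⟩⟩
        · refine Or.inl (Finset.mem_sdiff.2 ⟨hA, fun h => hs ?_⟩)
          obtain ⟨x, hx, hxe⟩ := Finset.mem_image.1 h
          have : x = ⟨e.1, hA⟩ := Subtype.ext hxe
          rwa [← this])
      have h1 : (s.image Subtype.val).card = s.card :=
        Finset.card_image_of_injective _ Subtype.val_injective
      have h2 : s.image Subtype.val ⊆ A := by
        intro x hx
        obtain ⟨y, -, rfl⟩ := Finset.mem_image.1 hx
        exact y.2
      have h3 := Finset.card_sdiff_add_card_eq_card h2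
      have h4 := Finset.card_union_le B N
      omega)
  refine ⟨f, hf, fun x => ?_⟩
  obtain ⟨e, he, hex⟩ := Finset.mem_image.1 (hf' x)
  simp only [Finset.mem_filter] at he
  obtain ⟨h1, h2, h3⟩ := he
  rw [← hex, ← h2]
  exact ⟨h1, h3⟩

/-- König's theorem: a matching and a vertex cover such that every vertex of the cover is matched
and every matching edge has exactly one end in the cover. -/
lemma exists_konig_matching {α β : Type*} (H : Finset (α × β)) :
    ∃ (A : Finset α) (B : Finset β) (M : Finset (α × β)), M ⊆ H ∧
      (∀ e ∈ H, e.1 ∈ A ∨ e.2 ∈ B) ∧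
      (∀ e ∈ M, ∀ e' ∈ M, e.1 = e'.1 ∨ e.2 = e'.2 → e = e') ∧
      (∀ e ∈ M, (e.1 ∈ A ∧ e.2 ∉ B) ∨ (e.1 ∉ A ∧ e.2 ∈ B)) ∧
      (∀ x ∈ A, ∃ e ∈ M, e.1 = x) ∧ (∀ y ∈ B, ∃ e ∈ M, e.2 = y) := by
  have hex : ∃ n, ∃ (A : Finset α) (B : Finset β),
      (∀ e ∈ H, e.1 ∈ A ∨ e.2 ∈ B) ∧ A.card + B.card = n :=
    ⟨_, H.image Prod.fst, ∅, fun e he => Or.inl (Finset.mem_image_of_mem _ he), rfl⟩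
  obtain ⟨A, B, hcov, hcard⟩ := Nat.find_spec hex
  have hmin : ∀ (A' : Finset α) (B' : Finset β), (∀ e ∈ H, e.1 ∈ A' ∨ e.2 ∈ B') →
      A.card + B.card ≤ A'.card + B'.card := fun A' B' h => by
    rw [hcard]; exact Nat.find_min' hex ⟨A', B', h, rfl⟩
  obtain ⟨f, hf, hf'⟩ := exists_matching_of_min_cover H A B hcov hmin
  obtain ⟨g, hg, hg'⟩ := exists_matching_of_min_cover (H.image Prod.swap) B A
    (by
      intro e he
      obtain ⟨e', he', rfl⟩ := Finset.mem_image.1 he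
      exact (hcov e' he').symm)
    (by
      intro B' A' h
      have := hmin A' B' (fun e he => (h e.swap (Finset.mem_image_of_mem _ he)).symm)
      omega)
  have hg'' : ∀ y, (g y, y.1) ∈ H ∧ g y ∉ A := fun y => by
    refine ⟨?_, (hg' y).2⟩
    obtain ⟨e, he, h⟩ := Finset.mem_image.1 (hg' y).1
    have : e = (g y, y.1) := by rw [← Prod.swap_swap e, h]; rfl
    rwa [← this]
  refine ⟨A, B, Finset.univ.image (fun x : A => (x.1, f x)) ∪
    Finset.univ.image (fun y : B => (g y, y.1)), ?_, hcov, ?_, ?_, ?_, ?_⟩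
  · intro e he
    simp only [Finset.mem_union, Finset.mem_image, Finset.mem_univ, true_and] at he
    rcases he with ⟨x, rfl⟩ | ⟨y, rfl⟩
    · exact (hf' x).1
    · exact (hg'' y).1
  · intro e he e' he' h
    simp only [Finset.mem_union, Finset.mem_image, Finset.mem_univ, true_and] at he he'
    rcases he with ⟨x, rfl⟩ | ⟨y, rfl⟩ <;> rcases he' with ⟨x', rfl⟩ | ⟨y', rfl⟩
    · have : x = x' := h.elim Subtype.ext (fun h => hf h)
      rw [this]
    · rcases h with h | h
      · exact absurd (show g y' ∈ A from (show x.1 = g y' from h) ▸ x.2) (hg'' y').2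
      · exact absurd (show f x ∈ B from (show f x = y'.1 from h) ▸ y'.2) (hf' x).2
    · rcases h with h | h
      · exact absurd (show g y ∈ A from (show g y = x'.1 from h) ▸ x'.2) (hg'' y).2
      · exact absurd (show f x' ∈ B from (show y.1 = f x' from h) ▸ y.2) (hf' x').2
    · have : y = y' := h.elim (fun h => hg h) Subtype.ext
      rw [this]
  · intro e he
    simp only [Finset.mem_union, Finset.mem_image, Finset.mem_univ, true_and] at he
    rcases he with ⟨x, rfl⟩ | ⟨y, rfl⟩
    · exact Or.inl ⟨x.2, (hf' x).2⟩
    · exact Or.inr ⟨(hg'' y).2, y.2⟩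
  · exact fun x hx => ⟨(x, f ⟨x, hx⟩), by simp [hx], rfl⟩
  · exact fun y hy => ⟨(g ⟨y, hy⟩, y), by simp [hy], rfl⟩

/-- Every bipartite graph has preferences for which each edge `e = uv` has fewer than
`max (deg u) (deg v)` adjacent edges preferred to it. -/
lemma exists_preferences_lt_max_degree {α β : Type*} (H : Finset (α × β)) :
    ∃ p q : α × β → ℕ,
      (∀ e ∈ H, ∀ e' ∈ H, e.1 = e'.1 → p e = p e' → e = e') ∧
      (∀ e ∈ H, ∀ e' ∈ H, e.2 = e'.2 → q e = q e' → e = e') ∧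
      ∀ e ∈ H, (H.filter (fun e' => e'.1 = e.1 ∧ p e < p e')).card +
        (H.filter (fun e' => e'.2 = e.2 ∧ q e < q e')).card <
        max (H.filter (fun e' => e'.1 = e.1)).card (H.filter (fun e' => e'.2 = e.2)).card := by
  induction H using Finset.strongInduction with
  | H H ih =>
  rcases H.eq_empty_or_nonempty with rfl | ⟨e₀, he₀⟩
  · exact ⟨0, 0, by simp, by simp, by simp⟩
  obtain ⟨A, B, M, hMH, hcov, hM, hone, hMA, hMB⟩ := exists_konig_matching H
  have hMne : M.Nonempty := by
    rcases hcov e₀ he₀ with h | h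
    · obtain ⟨e, he, -⟩ := hMA _ h
      exact ⟨e, he⟩
    · obtain ⟨e, he, -⟩ := hMB _ h
      exact ⟨e, he⟩
  obtain ⟨p, q, hp, hq, hlt⟩ := ih (H \ M) (Finset.sdiff_ssubset hMH hMne)
  obtain ⟨P, hP⟩ : ∃ P, ∀ e ∈ H, p e ≤ P := ⟨H.sup p, fun e he => Finset.le_sup he⟩
  obtain ⟨Q, hQ⟩ : ∃ Q, ∀ e ∈ H, q e ≤ Q := ⟨H.sup q, fun e he => Finset.le_sup he⟩
  set p' : α × β → ℕ := fun e => if e ∈ M then (if e.1 ∈ A then 0 else P + 2) else p e + 1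
    with hp'
  set q' : α × β → ℕ := fun e => if e ∈ M then (if e.2 ∈ B then 0 else Q + 2) else q e + 1
    with hq'
  have hpP : ∀ e ∈ H, p' e ≤ P + 2 := fun e he => by
    have := hP e he
    simp only [hp']
    split_ifs <;> omega
  have hqQ : ∀ e ∈ H, q' e ≤ Q + 2 := fun e he => by
    have := hQ e he
    simp only [hq']
    split_ifs <;> omega
  refine ⟨p', q', ?_, ?_, ?_⟩
  · intro e he e' he' h1 h2
    have := hP e he
    have := hP e' he'
    by_cases h : e ∈ M <;> by_cases h' : e' ∈ M
    · exact hM e h e' h' (Or.inl h1)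
    · simp only [hp', h, h', if_true, if_false] at h2
      split_ifs at h2
      all_goals omega
    · simp only [hp', h, h', if_true, if_false] at h2
      split_ifs at h2
      all_goals omega
    · simp only [hp', h, h', if_false] at h2
      exact hp e (Finset.mem_sdiff.2 ⟨he, h⟩) e' (Finset.mem_sdiff.2 ⟨he', h'⟩) h1 (by omega)
  · intro e he e' he' h1 h2
    have := hQ e he
    have := hQ e' he'
    by_cases h : e ∈ M <;> by_cases h' : e' ∈ M
    · exact hM e h e' h' (Or.inr h1)
    · simp only [hq', h, h', if_true, if_false] at h2
      split_ifs at h2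
      all_goals omega
    · simp only [hq', h, h', if_true, if_false] at h2
      split_ifs at h2
      all_goals omega
    · simp only [hq', h, h', if_false] at h2
      exact hq e (Finset.mem_sdiff.2 ⟨he, h⟩) e' (Finset.mem_sdiff.2 ⟨he', h'⟩) h1 (by omega)
  · intro e he
    by_cases heM : e ∈ M
    · have hlt1 : (H.filter (fun e' => e'.1 = e.1 ∧ p' e < p' e')).card <
          (H.filter (fun e' => e'.1 = e.1)).card :=
        Finset.card_lt_card ⟨fun x hx => by
          simp only [Finset.mem_filter] at hx ⊢
          exact ⟨hx.1, hx.2.1⟩, fun h => by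
          have : e ∈ H.filter (fun e' => e'.1 = e.1 ∧ p' e < p' e') := h (by simp [he])
          simp at this⟩
      have hlt2 : (H.filter (fun e' => e'.2 = e.2 ∧ q' e < q' e')).card <
          (H.filter (fun e' => e'.2 = e.2)).card :=
        Finset.card_lt_card ⟨fun x hx => by
          simp only [Finset.mem_filter] at hx ⊢
          exact ⟨hx.1, hx.2.1⟩, fun h => by
          have : e ∈ H.filter (fun e' => e'.2 = e.2 ∧ q' e < q' e') := h (by simp [he])
          simp at this⟩
      rcases hone e heM with ⟨hA, hB⟩ | ⟨hA, hB⟩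
      · have : (H.filter (fun e' => e'.2 = e.2 ∧ q' e < q' e')).card = 0 := by
          rw [Finset.card_eq_zero, Finset.filter_eq_empty_iff]
          rintro x hx ⟨-, h⟩
          have h1 := hqQ x hx
          have h2 : q' e = Q + 2 := by simp [hq', heM, hB]
          omega
        omega
      · have : (H.filter (fun e' => e'.1 = e.1 ∧ p' e < p' e')).card = 0 := by
          rw [Finset.card_eq_zero, Finset.filter_eq_empty_iff]
          rintro x hx ⟨-, h⟩
          have h1 := hpP x hx
          have h2 : p' e = P + 2 := by simp [hp', heM, hA]
          omega
        omega
    · have hsplit : ∀ (r : α × β → Prop) [DecidablePred r], (H.filter r).card =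
          ((H \ M).filter r).card + (M.filter r).card := fun r _ => by
        rw [← Finset.card_union_of_disjoint (Finset.disjoint_filter_filter
          Finset.sdiff_disjoint), ← Finset.filter_union, Finset.sdiff_union_of_subset hMH]
      have hM1 : (M.filter (fun e' => e'.1 = e.1)).card ≤ 1 := by
        rw [Finset.card_le_one]
        intro x hx y hy
        simp only [Finset.mem_filter] at hx hy
        exact hM x hx.1 y hy.1 (Or.inl (hx.2.trans hy.2.symm))
      have hM2 : (M.filter (fun e' => e'.2 = e.2)).card ≤ 1 := by
        rw [Finset.card_le_one]
        intro x hx y hy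
        simp only [Finset.mem_filter] at hx hy
        exact hM x hx.1 y hy.1 (Or.inr (hx.2.trans hy.2.symm))
      have hA1 : e.1 ∈ A → 0 < (M.filter (fun e' => e'.1 = e.1)).card ∧
          (M.filter (fun e' => e'.1 = e.1 ∧ p' e < p' e')).card = 0 := fun h => by
        constructor
        · obtain ⟨x, hx, hx'⟩ := hMA _ h
          exact Finset.card_pos.2 ⟨x, by simp [hx, hx']⟩
        · rw [Finset.card_eq_zero, Finset.filter_eq_empty_iff]
          rintro x hx ⟨h1, h2⟩
          have : p' x = 0 := by simp [hp', hx, h1, h]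
          omega
      have hB1 : e.2 ∈ B → 0 < (M.filter (fun e' => e'.2 = e.2)).card ∧
          (M.filter (fun e' => e'.2 = e.2 ∧ q' e < q' e')).card = 0 := fun h => by
        constructor
        · obtain ⟨x, hx, hx'⟩ := hMB _ h
          exact Finset.card_pos.2 ⟨x, by simp [hx, hx']⟩
        · rw [Finset.card_eq_zero, Finset.filter_eq_empty_iff]
          rintro x hx ⟨h1, h2⟩
          have : q' x = 0 := by simp [hq', hx, h1, h]
          omega
      have hA2 : (M.filter (fun e' => e'.1 = e.1 ∧ p' e < p' e')).card ≤
          (M.filter (fun e' => e'.1 = e.1)).card :=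
        Finset.card_le_card (Finset.monotone_filter_right _ fun _ _ h => h.1)
      have hB2 : (M.filter (fun e' => e'.2 = e.2 ∧ q' e < q' e')).card ≤
          (M.filter (fun e' => e'.2 = e.2)).card :=
        Finset.card_le_card (Finset.monotone_filter_right _ fun _ _ h => h.1)
      have hp1 : ((H \ M).filter (fun e' => e'.1 = e.1 ∧ p' e < p' e')) =
          ((H \ M).filter (fun e' => e'.1 = e.1 ∧ p e < p e')) :=
        Finset.filter_congr fun x hx => by
          simp [hp', heM, (Finset.mem_sdiff.1 hx).2]
      have hq1 : ((H \ M).filter (fun e' => e'.2 = e.2 ∧ q' e < q' e')) =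
          ((H \ M).filter (fun e' => e'.2 = e.2 ∧ q e < q e')) :=
        Finset.filter_congr fun x hx => by
          simp [hq', heM, (Finset.mem_sdiff.1 hx).2]
      have hmain := hlt e (Finset.mem_sdiff.2 ⟨he, heM⟩)
      rw [hsplit (fun e' => e'.1 = e.1 ∧ p' e < p' e'),
        hsplit (fun e' => e'.2 = e.2 ∧ q' e < q' e'), hsplit (fun e' => e'.1 = e.1),
        hsplit (fun e' => e'.2 = e.2), hp1, hq1]
      rcases hcov e he with h | h
      · by_cases h' : e.2 ∈ B
        · have := hA1 h
          have := hB1 h'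
          omega
        · have := hA1 h
          omega
      · have := hB1 h
        omega

/-- The Borodin–Kostochka–Woodall theorem: a bipartite graph can be edge-colored from lists with
`max (deg u) (deg v) ≤ |L (uv)|` for every edge `uv`. -/
lemma exists_bipartite_list_coloring {α β : Type*} (H : Finset (α × β))
    (L : α × β → Finset ℕ)
    (hL : ∀ e ∈ H, max (H.filter (fun e' => e'.1 = e.1)).card
      (H.filter (fun e' => e'.2 = e.2)).card ≤ (L e).card) :
    ∃ c : α × β → ℕ, (∀ e ∈ H, c e ∈ L e) ∧
      ∀ e ∈ H, ∀ e' ∈ H, e ≠ e' → e.1 = e'.1 ∨ e.2 = e'.2 → c e ≠ c e' := by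
  obtain ⟨p, q, hp, hq, h⟩ := exists_preferences_lt_max_degree H
  exact exists_list_coloring_of_preferences p q H hp hq L
    fun e he => (h e he).trans_le (hL e he)

/-- A list edge-coloring of `K` extends to `G` when `G` arises from `K` by adding a bipartite graph
`H` whose edges have long enough lists. -/
lemma exists_extension_to_bipartite_part {V : Type*} [Fintype V] (G K : SimpleGraph V)
    (L : Sym2 V → Finset ℕ) (A : V → Prop) (H : Finset (V × V))
    (hH : ∀ h ∈ H, G.Adj h.1 h.2 ∧ A h.1 ∧ ¬ A h.2)
    (hK : ∀ x y, K.Adj x y ↔ G.Adj x y ∧ (x, y) ∉ H ∧ (y, x) ∉ H)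
    (f : Sym2 V → ℕ) (hf : IsProperListEdgeColoring K L f)
    (hL : ∀ h ∈ H, (Finset.univ.filter (G.Adj h.1)).card + (Finset.univ.filter (G.Adj h.2)).card +
      max (H.filter (fun e => e.1 = h.1)).card (H.filter (fun e => e.2 = h.2)).card ≤
      (L s(h.1, h.2)).card + (H.filter (fun e => e.1 = h.1)).card +
        (H.filter (fun e => e.2 = h.2)).card) :
    ∃ f, IsProperListEdgeColoring G L f := by
  have hd1 : ∀ x, (Finset.univ.filter (K.Adj x)).card + (H.filter (fun e => e.1 = x)).card ≤
      (Finset.univ.filter (G.Adj x)).card := fun x => by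
    have hi : ((H.filter (fun e => e.1 = x)).image Prod.snd).card =
        (H.filter (fun e => e.1 = x)).card := Finset.card_image_of_injOn fun a ha b hb hab => by
      simp only [Finset.coe_filter, Set.mem_ofPred_eq] at ha hb
      exact Prod.ext (ha.2.trans hb.2.symm) hab
    rw [← hi, ← Finset.card_union_of_disjoint]
    · refine Finset.card_le_card fun y hy => ?_
      simp only [Finset.mem_union, Finset.mem_filter, Finset.mem_univ, true_and,
        Finset.mem_image] at hy ⊢
      rcases hy with hy | ⟨h, ⟨hh, rfl⟩, rfl⟩
      · exact ((hK x y).1 hy).1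
      · exact (hH h hh).1
    · rw [Finset.disjoint_left]
      rintro y hy hy'
      simp only [Finset.mem_filter, Finset.mem_univ, true_and, Finset.mem_image] at hy hy'
      obtain ⟨h, ⟨hh, rfl⟩, rfl⟩ := hy'
      exact ((hK _ _).1 hy).2.1 hh
  have hd2 : ∀ x, (Finset.univ.filter (K.Adj x)).card + (H.filter (fun e => e.2 = x)).card ≤
      (Finset.univ.filter (G.Adj x)).card := fun x => by
    have hi : ((H.filter (fun e => e.2 = x)).image Prod.fst).card =
        (H.filter (fun e => e.2 = x)).card := Finset.card_image_of_injOn fun a ha b hb hab => by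
      simp only [Finset.coe_filter, Set.mem_ofPred_eq] at ha hb
      exact Prod.ext hab (ha.2.trans hb.2.symm)
    rw [← hi, ← Finset.card_union_of_disjoint]
    · refine Finset.card_le_card fun y hy => ?_
      simp only [Finset.mem_union, Finset.mem_filter, Finset.mem_univ, true_and,
        Finset.mem_image] at hy ⊢
      rcases hy with hy | ⟨h, ⟨hh, rfl⟩, rfl⟩
      · exact ((hK x y).1 hy).1
      · exact (hH h hh).1.symm
    · rw [Finset.disjoint_left]
      rintro y hy hy'
      simp only [Finset.mem_filter, Finset.mem_univ, true_and, Finset.mem_image] at hy hy'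
      obtain ⟨h, ⟨hh, rfl⟩, rfl⟩ := hy'
      exact ((hK _ _).1 hy).2.2 hh
  obtain ⟨c, hc, hc'⟩ := exists_bipartite_list_coloring H
    (fun h => L s(h.1, h.2) \ ((Finset.univ.filter (K.Adj h.1)).image (fun w => f s(h.1, w)) ∪
      (Finset.univ.filter (K.Adj h.2)).image (fun w => f s(h.2, w)))) (by
      intro h hh
      have h1 := hL h hh
      have h2 := hd1 h.1
      have h3 := hd2 h.2
      have h4 := Finset.le_card_sdiff
        ((Finset.univ.filter (K.Adj h.1)).image (fun w => f s(h.1, w)) ∪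
          (Finset.univ.filter (K.Adj h.2)).image (fun w => f s(h.2, w))) (L s(h.1, h.2))
      have h5 := Finset.card_union_le
        ((Finset.univ.filter (K.Adj h.1)).image (fun w => f s(h.1, w)))
        ((Finset.univ.filter (K.Adj h.2)).image (fun w => f s(h.2, w)))
      have h6 := Finset.card_image_le (s := Finset.univ.filter (K.Adj h.1))
        (f := fun w => f s(h.1, w))
      have h7 := Finset.card_image_le (s := Finset.univ.filter (K.Adj h.2))
        (f := fun w => f s(h.2, w))
      omega)
  have hinj : ∀ h ∈ H, ∀ h' ∈ H, s(h.1, h.2) = s(h'.1, h'.2) → h = h' := by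
    intro h hh h' hh' heq
    rcases Sym2.eq_iff.1 heq with ⟨h1, h2⟩ | ⟨h1, h2⟩
    · exact Prod.ext h1 h2
    · exact absurd (h1 ▸ (hH h hh).2.1) (hH h' hh').2.2
  set g : Sym2 V → ℕ := fun e =>
    if h : ∃ h ∈ H, s(h.1, h.2) = e then c h.choose else f e with hg
  have hgH : ∀ h ∈ H, g s(h.1, h.2) = c h := by
    intro h hh
    have hex : ∃ h' ∈ H, s(h'.1, h'.2) = s(h.1, h.2) := ⟨h, hh, rfl⟩
    simp only [hg, dif_pos hex]
    rw [hinj _ hex.choose_spec.1 h hh hex.choose_spec.2]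
  have hgK : ∀ e ∈ K.edgeSet, g e = f e := by
    intro e he
    have hex : ¬ ∃ h ∈ H, s(h.1, h.2) = e := by
      rintro ⟨h, hh, rfl⟩
      exact ((hK _ _).1 ((SimpleGraph.mem_edgeSet K).1 he)).2.1 hh
    simp only [hg, dif_neg hex]
  have hsplit : ∀ e ∈ G.edgeSet, (∃ h ∈ H, e = s(h.1, h.2)) ∨ e ∈ K.edgeSet := by
    intro e
    induction e using Sym2.ind with
    | _ x y =>
    intro he
    by_cases h1 : (x, y) ∈ H
    · exact Or.inl ⟨_, h1, rfl⟩
    by_cases h2 : (y, x) ∈ H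
    · exact Or.inl ⟨_, h2, Sym2.eq_swap⟩
    exact Or.inr ((SimpleGraph.mem_edgeSet K).2
      ((hK x y).2 ⟨(SimpleGraph.mem_edgeSet G).1 he, h1, h2⟩))
  have hcross : ∀ h ∈ H, ∀ e ∈ K.edgeSet, ∀ v, v ∈ s(h.1, h.2) → v ∈ e → c h ≠ f e := by
    intro h hh e he v hv hve heq
    obtain ⟨w, rfl⟩ := hve
    have hnot := (Finset.mem_sdiff.1 (hc h hh)).2
    apply hnot
    have hadj := (SimpleGraph.mem_edgeSet K).1 he
    rw [Finset.mem_union, Finset.mem_image, Finset.mem_image]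
    rcases Sym2.mem_iff.1 hv with rfl | rfl
    · exact Or.inl ⟨w, by simp [hadj], heq.symm⟩
    · exact Or.inr ⟨w, by simp [hadj], heq.symm⟩
  refine ⟨g, fun e he => ?_, fun e he e' he' hne hv => ?_⟩
  · rcases hsplit e he with ⟨h, hh, rfl⟩ | h
    · rw [hgH h hh]
      exact (Finset.mem_sdiff.1 (hc h hh)).1
    · rw [hgK e h]
      exact hf.1 e h
  · obtain ⟨v, hv, hw⟩ := hv
    rcases hsplit e he with ⟨h, hh, rfl⟩ | h <;> rcases hsplit e' he' with ⟨h', hh', rfl⟩ | h'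
    · rw [hgH h hh, hgH h' hh']
      refine hc' h hh h' hh' (fun h0 => hne (by rw [h0])) ?_
      rcases Sym2.mem_iff.1 hv with h1 | h1 <;> rcases Sym2.mem_iff.1 hw with h2 | h2
      · exact Or.inl (h1.symm.trans h2)
      · exact absurd (h1.symm.trans h2 ▸ (hH h hh).2.1) (hH h' hh').2.2
      · exact absurd (h2.symm.trans h1 ▸ (hH h' hh').2.1) (hH h hh).2.2
      · exact Or.inr (h1.symm.trans h2)
    · rw [hgH h hh, hgK e' h']
      exact hcross h hh e' h' v hv hw
    · rw [hgH h' hh', hgK e h]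
      exact (hcross h' hh' e h v hw hv).symm
    · rw [hgK e h, hgK e' h']
      exact hf.2 e h e' h' hne ⟨v, hv, hw⟩

/-- Peeling off bad edges one at a time selects the edges along which charge is sent: every left
vertex keeps all but `d u - 2` of its edges, and the charge leaving a right vertex is bounded. -/
lemma exists_discharging_edges {V : Type*} (d : V → ℕ) (Δ : ℕ) (H : Finset (V × V))
    (hd : ∀ h ∈ H, d h.2 ≤ Δ)
    (hbad : ∀ H' ⊆ H, H'.Nonempty → ∃ h ∈ H',
      min (H'.filter (fun e => e.1 = h.1)).card (H'.filter (fun e => e.2 = h.2)).card + Δ + 2 ≤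
        d h.1 + d h.2) :
    ∃ F ⊆ H,
      (∀ u, (H.filter (fun e => e.1 = u)).card ≤ (F.filter (fun e => e.1 = u)).card + (d u - 2)) ∧
      ∀ v, ∑ h ∈ F.filter (fun e => e.2 = v), (Δ + 3 - 2 * d h.1) ≤
        ∑ i ∈ Finset.range (H.filter (fun e => e.2 = v)).card,
          (2 * d v - Δ - 1 - 2 * (i + 1)) := by
  induction H using Finset.strongInduction with
  | H H ih =>
  rcases H.eq_empty_or_nonempty with rfl | hne
  · exact ⟨∅, by simp, by simp, by simp⟩
  obtain ⟨h, hh, hmin⟩ := hbad H subset_rfl hne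
  have hsub := Finset.erase_subset h H
  obtain ⟨F, hF, hF1, hF2⟩ := ih (H.erase h) (Finset.erase_ssubset hh)
    (fun e he => hd e (hsub he)) (fun H' hH' => hbad H' (hH'.trans hsub))
  have hnot : h ∉ F := fun h' => by simpa using hF h'
  have hcard1 : ∀ u, (H.filter (fun e => e.1 = u)).card =
      ((H.erase h).filter (fun e => e.1 = u)).card + if h.1 = u then 1 else 0 := fun u => by
    conv_lhs => rw [← Finset.insert_erase hh, Finset.filter_insert]
    split_ifs with h0
    · rw [Finset.card_insert_of_notMem (by simp)]
    · rfl
  have hcard2 : ∀ v, (H.filter (fun e => e.2 = v)).card =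
      ((H.erase h).filter (fun e => e.2 = v)).card + if h.2 = v then 1 else 0 := fun v => by
    conv_lhs => rw [← Finset.insert_erase hh, Finset.filter_insert]
    split_ifs with h0
    · rw [Finset.card_insert_of_notMem (by simp)]
    · rfl
  have hdh := hd h hh
  by_cases hcase : (H.filter (fun e => e.2 = h.2)).card + Δ + 2 ≤ d h.1 + d h.2
  · refine ⟨insert h F, Finset.insert_subset hh (hF.trans hsub), fun u => ?_, fun v => ?_⟩
    · have h1 := hF1 u
      rw [hcard1 u, Finset.filter_insert]
      split_ifs with h0
      · rw [Finset.card_insert_of_notMem (by simp [hnot])]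
        omega
      · omega
    · have h2 := hF2 v
      have h3 := hcard2 v
      rw [Finset.filter_insert]
      split_ifs at h3 ⊢ with h0
      · rw [Finset.sum_insert (by simp [hnot]), h3, Finset.sum_range_succ]
        subst h0
        rw [h3] at hcase
        omega
      · rw [h3]
        exact h2
  · refine ⟨F, hF.trans hsub, fun u => ?_, fun v => (hF2 v).trans ?_⟩
    · have h1 := hF1 u
      have h2 := hcard1 u
      split_ifs at h2 with h0
      · subst h0
        omega
      · omega
    · have h3 := hcard2 v
      exact Finset.sum_le_sum_of_subset (Finset.range_mono (by omega))

lemma sum_range_sub_two_mul_le {D : ℕ} (hD : D ≤ 8) (n : ℕ) :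
    ∑ i ∈ Finset.range n, (D - 2 * (i + 1)) ≤ 2 * (D - 2) :=
  calc ∑ i ∈ Finset.range n, (D - 2 * (i + 1))
      ≤ ∑ i ∈ Finset.range 4, (D - 2 * (i + 1)) :=
        Finset.sum_le_sum_of_ne_zero fun i _ hi => Finset.mem_range.2 (by omega)
    _ ≤ 2 * (D - 2) := by interval_cases D <;> decide

/-- If all bipartite pieces are irreducible, the average degree over the non-isolated vertices is
at least `(Δ + 3) / 2`. -/
lemma card_mul_le_two_mul_sum_degree {V : Type*} [Fintype V] (G : SimpleGraph V) (d : V → ℕ)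
    (hd : ∀ v, d v = (Finset.univ.filter (G.Adj v)).card) (Δ : ℕ) (hΔ : ∀ v, d v ≤ Δ) (hΔ9 : Δ ≤ 9)
    (hirr : ∀ (A : V → Prop) (H : Finset (V × V)), H.Nonempty →
      (∀ h ∈ H, G.Adj h.1 h.2 ∧ A h.1 ∧ ¬ A h.2) → ∃ h ∈ H,
      min (H.filter (fun e => e.1 = h.1)).card (H.filter (fun e => e.2 = h.2)).card + Δ + 2 ≤
        d h.1 + d h.2) :
    (Finset.univ.filter (fun v => 0 < d v)).card * (Δ + 3) ≤
      2 * ∑ v ∈ Finset.univ.filter (fun v => 0 < d v), d v := by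
  have hedge : ∀ u v, G.Adj u v → Δ + 3 ≤ d u + d v := by
    intro u v huv
    obtain ⟨h, hh, hle⟩ := hirr (fun x => x = u) {(u, v)} (by simp) (by
      simp [huv, huv.ne'])
    rw [Finset.mem_singleton] at hh
    subst hh
    simp [Finset.filter_singleton] at hle
    omega
  set P : Finset (V × V) := Finset.univ.filter (fun h => G.Adj h.1 h.2 ∧ 2 * d h.1 < Δ + 3)
    with hP
  obtain ⟨F, -, hF1, hF2⟩ := exists_discharging_edges d Δ P (fun h _ => hΔ _) (fun H hH hne =>
    hirr (fun x => 2 * d x < Δ + 3) H hne (fun h hh => by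
      have h1 := hH hh
      simp only [hP, Finset.mem_filter, Finset.mem_univ, true_and] at h1
      have := hedge _ _ h1.1
      exact ⟨h1.1, h1.2, by omega⟩))
  have hlow : ∀ u, 0 < d u → 2 * (Δ + 3 - 2 * d u) ≤
      (F.filter (fun e => e.1 = u)).card * (Δ + 3 - 2 * d u) := by
    intro u hu
    by_cases hu' : 2 * d u < Δ + 3
    · refine Nat.mul_le_mul_right _ ?_
      have h1 := hF1 u
      have h2 : (P.filter (fun e => e.1 = u)).card = d u := by
        rw [hd u]
        refine Finset.card_bij (fun e _ => e.2) ?_ ?_ ?_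
        · intro e he
          simp only [hP, Finset.mem_filter, Finset.mem_univ, true_and] at he ⊢
          exact he.2 ▸ he.1.1
        · intro e he e' he' h
          simp only [Finset.mem_filter] at he he'
          exact Prod.ext (he.2.trans he'.2.symm) h
        · intro w hw
          simp only [Finset.mem_filter, Finset.mem_univ, true_and] at hw
          exact ⟨(u, w), by simp [hP, hw, hu'], rfl⟩
      have h3 : 3 ≤ d u := by
        have hu0 := hu
        rw [hd u, Finset.card_pos] at hu0
        obtain ⟨w, hw⟩ := hu0
        simp only [Finset.mem_filter, Finset.mem_univ, true_and] at hw
        have := hedge u w hw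
        have := hΔ w
        omega
      omega
    · have : Δ + 3 - 2 * d u = 0 := by omega
      simp [this]
  have hsum : ∑ u, (F.filter (fun e => e.1 = u)).card * (Δ + 3 - 2 * d u) =
      ∑ v, ∑ h ∈ F.filter (fun e => e.2 = v), (Δ + 3 - 2 * d h.1) := by
    rw [Finset.sum_fiberwise F (fun e => e.2) (fun h => Δ + 3 - 2 * d h.1),
      ← Finset.sum_fiberwise F (fun e => e.1) (fun h => Δ + 3 - 2 * d h.1)]
    refine Finset.sum_congr rfl fun u _ => ?_
    rw [Finset.sum_congr rfl (g := fun _ => Δ + 3 - 2 * d u) (fun h hh => by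
      rw [(Finset.mem_filter.1 hh).2]), Finset.sum_const, smul_eq_mul]
  set N := Finset.univ.filter (fun v => 0 < d v) with hN
  have hright : ∀ v, ∑ h ∈ F.filter (fun e => e.2 = v), (Δ + 3 - 2 * d h.1) ≤
      2 * (2 * d v - (Δ + 3)) := fun v => by
    have h1 := hF2 v
    have h2 := sum_range_sub_two_mul_le (D := 2 * d v - Δ - 1) (by have := hΔ v; omega)
      (P.filter (fun e => e.2 = v)).card
    omega
  have hkey : ∑ v ∈ N, (Δ + 3 - 2 * d v) ≤ ∑ v ∈ N, (2 * d v - (Δ + 3)) := by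
    have h1 : ∑ v ∈ N, 2 * (Δ + 3 - 2 * d v) ≤
        ∑ u, (F.filter (fun e => e.1 = u)).card * (Δ + 3 - 2 * d u) :=
      (Finset.sum_le_sum fun u hu => hlow u (Finset.mem_filter.1 hu).2).trans
        (Finset.sum_le_sum_of_subset (Finset.subset_univ N))
    have h2 : ∑ v, 2 * (2 * d v - (Δ + 3)) = ∑ v ∈ N, 2 * (2 * d v - (Δ + 3)) := by
      refine (Finset.sum_subset (Finset.subset_univ N) fun v _ hv => ?_).symm
      simp only [hN, Finset.mem_filter, Finset.mem_univ, true_and] at hv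
      omega
    have h3 := h1.trans (hsum.le.trans ((Finset.sum_le_sum fun v _ => hright v).trans h2.le))
    rw [← Finset.mul_sum, ← Finset.mul_sum] at h3
    omega
  have hbal : ∑ v ∈ N, (Δ + 3 - 2 * d v) + ∑ v ∈ N, 2 * d v =
      ∑ v ∈ N, (2 * d v - (Δ + 3)) + ∑ v ∈ N, (Δ + 3) := by
    rw [← Finset.sum_add_distrib, ← Finset.sum_add_distrib]
    exact Finset.sum_congr rfl fun v _ => by omega
  rw [Finset.mul_sum]
  rw [Finset.sum_const, smul_eq_mul] at hbal
  omega

theorem stmt_5 {V : Type*} [Fintype V] (G : SimpleGraph V) [DecidableRel G.Adj]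
    (Δ : ℕ) (hΔ : G.maxDegree = Δ) (hΔ9 : Δ ≤ 9)
    (hmad : MadLT G (((Δ : ℝ) + 3) / 2)) :
    listChromaticIndex G ≤ Δ + 1 := by
  refine Nat.sInf_le fun L hL => ?_
  suffices hmain : ∀ E : Finset (V × V), ∀ K ≤ G,
      E = Finset.univ.filter (fun e : V × V => K.Adj e.1 e.2) →
      ∃ f, IsProperListEdgeColoring K L f from hmain _ G le_rfl rfl
  intro E
  induction E using Finset.strongInduction with
  | H E ih =>
  rintro K hKG rfl
  by_contra hno
  set d : V → ℕ := fun v => (Finset.univ.filter (K.Adj v)).card with hd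
  have hdΔ : ∀ v, d v ≤ Δ := fun v => by
    rw [← hΔ]
    refine le_trans ?_ (G.degree_le_maxDegree v)
    rw [← SimpleGraph.card_neighborFinset_eq_degree]
    refine Finset.card_le_card fun w hw => ?_
    simp only [Finset.mem_filter, Finset.mem_univ, true_and] at hw
    simpa using hKG hw
  have hcard := card_mul_le_two_mul_sum_degree K d (fun _ => rfl) Δ hdΔ hΔ9 (by
    intro A H hne hH
    by_contra! hcon
    obtain ⟨h₀, hh₀⟩ := hne
    let K' : SimpleGraph V :=
      { Adj := fun x y => K.Adj x y ∧ (x, y) ∉ H ∧ (y, x) ∉ H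
        symm := ⟨fun x y h => ⟨h.1.symm, h.2.2, h.2.1⟩⟩
        loopless := ⟨fun x h => K.loopless.irrefl x h.1⟩ }
    obtain ⟨f, hf⟩ := ih (Finset.univ.filter (fun e : V × V => K'.Adj e.1 e.2)) ⟨fun e he => by
        simp only [Finset.mem_filter, Finset.mem_univ, true_and] at he ⊢
        exact he.1, fun hsub => by
        have h1 : h₀ ∈ Finset.univ.filter (fun e : V × V => K'.Adj e.1 e.2) :=
          hsub (by simpa using (hH h₀ hh₀).1)
        simp only [Finset.mem_filter, Finset.mem_univ, true_and] at h1
        exact h1.2.1 hh₀⟩ K' (fun x y h => hKG h.1)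
        (by ext; simp)
    refine hno (exists_extension_to_bipartite_part K K' L A H hH (fun _ _ => Iff.rfl) f hf ?_)
    intro h hh
    have h1 := hcon h hh
    have h2 := hL s(h.1, h.2) ((SimpleGraph.mem_edgeSet G).2 (hKG (hH h hh).1))
    simp only [hd] at h1
    omega)
  set N := Finset.univ.filter (fun v => 0 < d v) with hN
  have hadjN : ∀ {x y}, K.Adj x y → 0 < d x := fun {x y} h =>
    Finset.card_pos.2 ⟨y, by simp [h]⟩
  have hNne : N.Nonempty := by
    by_contra hempty
    rw [Finset.not_nonempty_iff_eq_empty] at hempty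
    have hnone : ∀ e, e ∉ K.edgeSet := by
      intro e
      induction e using Sym2.ind with
      | _ x y =>
      intro he
      have : x ∈ N := by simpa [hN] using hadjN ((SimpleGraph.mem_edgeSet K).1 he)
      simp [hempty] at this
    exact hno ⟨fun _ => 0, fun e he => absurd he (hnone e), fun e he => absurd he (hnone e)⟩
  obtain ⟨S, hSv, hSadj⟩ : ∃ S : G.Subgraph, S.verts = {v | 0 < d v} ∧ S.Adj = K.Adj :=
    ⟨{  verts := {v | 0 < d v}
        Adj := K.Adj
        adj_sub := fun h => hKG h
        edge_vert := fun h => hadjN h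
        symm := K.symm }, rfl, rfl⟩
  have hSN : ∀ [Fintype S.verts], S.verts.toFinset = N := by
    intro _
    ext v
    simp [hSv, hN]
  have hS := hmad S (by
    obtain ⟨v, hv⟩ := hNne
    exact ⟨v, hSv ▸ (Finset.mem_filter.1 hv).2⟩)
  have hdeg : ∀ v, (S.neighborSet v).ncard = d v := fun v => by
    simp only [hd]
    rw [← Set.ncard_coe_finset]
    congr 1
    ext w
    simp [hSadj, SimpleGraph.Subgraph.mem_neighborSet]
  rw [@hSN _, div_lt_iff₀ (by exact_mod_cast hNne.card_pos)] at hS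
  simp only [hdeg] at hS
  have hcast : (N.card : ℝ) * (Δ + 3) ≤ 2 * ∑ v ∈ N, (d v : ℝ) := by exact_mod_cast hcard
  linarith
end

section
/- If G is a finite simple graph with maximum degree Δ = 5 and mad(G) < 4, then χ'_ℓ(G) ≤ 6. -/
open scoped Classical

/-- A list-coloring of the edges outside `S`, together with a compatible list-coloring of the
edges in `S`, gives a list-coloring of all edges. -/
theorem exists_isProperListEdgeColoring_of_deleteEdges {V : Type*} {G : SimpleGraph V}
    {L : Sym2 V → Finset ℕ} {S : Set (Sym2 V)} {f g : Sym2 V → ℕ}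
    (hf : IsProperListEdgeColoring (G.deleteEdges S) L f)
    (hgL : ∀ e ∈ S, g e ∈ L e)
    (hgf : ∀ e ∈ S, ∀ e' ∈ (G.deleteEdges S).edgeSet, (∃ v, v ∈ e ∧ v ∈ e') → g e ≠ f e')
    (hgg : ∀ e ∈ S, ∀ e' ∈ S, e ≠ e' → (∃ v, v ∈ e ∧ v ∈ e') → g e ≠ g e') :
    ∃ h, IsProperListEdgeColoring G L h := by
  refine ⟨fun e => if e ∈ S then g e else f e, fun e he => ?_, fun e he e' he' hne hv => ?_⟩
  · by_cases h : e ∈ S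
    · simpa [h] using hgL e h
    · simpa [h] using hf.1 e (by simp [SimpleGraph.edgeSet_deleteEdges, he, h])
  · by_cases h : e ∈ S <;> by_cases h' : e' ∈ S <;> simp only [h, h', if_true, if_false]
    · exact hgg e h e' h' hne hv
    · exact hgf e h e' (by simp [SimpleGraph.edgeSet_deleteEdges, he', h']) hv
    · obtain ⟨v, h1, h2⟩ := hv
      exact (hgf e' h' e (by simp [SimpleGraph.edgeSet_deleteEdges, he, h]) ⟨v, h2, h1⟩).symm
    · exact hf.2 e (by simp [SimpleGraph.edgeSet_deleteEdges, he, h]) e'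
        (by simp [SimpleGraph.edgeSet_deleteEdges, he', h']) hne hv

/-- The colors of `A` that `f` uses on no edge of `G` at `u` or `v`. -/
noncomputable def availableColors {V : Type*} [Fintype V] (G : SimpleGraph V) (f : Sym2 V → ℕ)
    (A : Finset ℕ) (u v : V) : Finset ℕ :=
  A \ (G.incidenceFinset u ∪ G.incidenceFinset v).image f

theorem card_le_card_availableColors {V : Type*} [Fintype V] (G : SimpleGraph V)
    [DecidableRel G.Adj] (f : Sym2 V → ℕ) (A : Finset ℕ) (u v : V) :
    A.card ≤ (availableColors G f A u v).card + G.degree u + G.degree v := by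
  have h1 := Finset.le_card_sdiff ((G.incidenceFinset u ∪ G.incidenceFinset v).image f) A
  have h2 := Finset.card_image_le (s := G.incidenceFinset u ∪ G.incidenceFinset v) (f := f)
  have h3 := Finset.card_union_le (G.incidenceFinset u) (G.incidenceFinset v)
  rw [G.card_incidenceFinset_eq_degree, G.card_incidenceFinset_eq_degree] at h3
  unfold availableColors
  convert (by omega : A.card ≤ (A \ (G.incidenceFinset u ∪ G.incidenceFinset v).image f).card +
    G.degree u + G.degree v)

theorem mem_of_mem_availableColors {V : Type*} [Fintype V] {G : SimpleGraph V} {f : Sym2 V → ℕ}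
    {A : Finset ℕ} {u v : V} {c : ℕ} (hc : c ∈ availableColors G f A u v) : c ∈ A :=
  (Finset.mem_sdiff.1 hc).1

theorem ne_of_mem_availableColors {V : Type*} [Fintype V] {G : SimpleGraph V} {f : Sym2 V → ℕ}
    {A : Finset ℕ} {u v : V} {c : ℕ} (hc : c ∈ availableColors G f A u v) {e : Sym2 V}
    (he : e ∈ G.edgeSet) (hv : ∃ x, x ∈ s(u, v) ∧ x ∈ e) : c ≠ f e := by
  rintro rfl
  refine (Finset.mem_sdiff.1 hc).2 (Finset.mem_image_of_mem f ?_)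
  obtain ⟨x, hx, hxe⟩ := hv
  rcases Sym2.mem_iff.1 hx with rfl | rfl <;>
    simp [SimpleGraph.incidenceSet, he, hxe]

/-- Cyclically indexed lists of size two admit a choice with consecutive choices distinct, provided
there is a predicate alternating along the cycle. -/
theorem exists_cyclic_choice {m : ℕ} (M : Fin (m + 1) → Finset ℕ) (hM : ∀ i, 2 ≤ (M i).card)
    (q : Fin (m + 1) → Prop) (hq : ∀ i, q (i + 1) ↔ ¬ q i) :
    ∃ c : Fin (m + 1) → ℕ, ∀ i, c i ∈ M i ∧ c i ≠ c (i + 1) := by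
  by_cases h : ∀ i, M (i + 1) ⊆ M i
  · obtain ⟨a, ha, b, hb, hab⟩ := Finset.one_lt_card.1 (hM (Fin.last m))
    have hlast : ∀ i, M (Fin.last m) ⊆ M i := by
      intro i
      induction i using Fin.reverseInduction with
      | last => exact subset_rfl
      | cast i ih =>
        have := h i.castSucc
        rw [Fin.coeSucc_eq_succ] at this
        exact ih.trans this
    refine ⟨fun i => if q i then a else b, fun i => ⟨?_, ?_⟩⟩
    · dsimp only
      split_ifs
      exacts [hlast i ha, hlast i hb]
    · by_cases hi : q i <;> simp [hq, hi, hab, hab.symm]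
  · push Not at h
    obtain ⟨i, hi⟩ := h
    obtain ⟨x, hx, hx'⟩ := Finset.not_subset.1 hi
    have hpick : ∀ (k : ℕ) (y : ℕ), ∃ z ∈ M (Fin.ofNat (m + 1) (k + 1) + (i + 1)), z ≠ y :=
      fun k y => Finset.exists_mem_ne (hM _) y
    choose pick hpick hpick' using hpick
    let d : ℕ → ℕ := fun k => Nat.rec x pick k
    have hd0 : d 0 = x := rfl
    have hd : ∀ k, d (k + 1) = pick k (d k) := fun k => rfl
    have hdM : ∀ j : Fin (m + 1), d j.val ∈ M (j + (i + 1)) := by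
      intro j
      rcases hj : j.val with _ | k
      · have : j = 0 := Fin.ext hj
        simpa [this, hd0] using hx
      · have : Fin.ofNat (m + 1) (k + 1) = j := by
          rw [← hj]; exact Fin.ofNat_val_eq_self j
        have hk := hpick k (d k)
        rwa [this] at hk
    refine ⟨fun j => d (j - (i + 1)).val, fun j => ⟨?_, ?_⟩⟩
    · simpa using hdM (j - (i + 1))
    · have hj : j + 1 - (i + 1) = j - (i + 1) + 1 := by abel
      have hj' := hdM (j - (i + 1))
      rw [sub_add_cancel] at hj'
      dsimp only
      rw [hj]
      by_cases hl : j - (i + 1) = Fin.last m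
      · have hji : j = i := by
          have : j - (i + 1) + 1 = 0 := by rw [hl]; simp
          rw [← hj] at this
          simpa [sub_eq_zero] using this
        subst hji
        have : (j - (j + 1) + 1).val = 0 := by rw [hl]; simp
        simp only [this, hd0]
        rintro h
        exact hx' (h ▸ hj')
      · rw [Fin.val_add_one_of_lt (Fin.lt_last_iff_ne_last.2 hl), hd]
        exact (hpick' _ _).symm

/-- If the edges outside a cycle `w` are list-colored, all lists have size at least six, degree sums
along the cycle are at most eight, and some predicate alternates along the cycle, then the graph is
list-colorable. -/
theorem exists_isProperListEdgeColoring_of_cycle {V : Type*} [Fintype V] {G : SimpleGraph V}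
    {L : Sym2 V → Finset ℕ} (hL : ∀ e ∈ G.edgeSet, 6 ≤ (L e).card) {m : ℕ} {w : Fin (m + 3) → V}
    (hw : Function.Injective w) (hadj : ∀ i, G.Adj (w i) (w (i + 1)))
    (hdeg : ∀ i, G.degree (w i) + G.degree (w (i + 1)) ≤ 8)
    {q : V → Prop} (hq : ∀ i, q (w (i + 1)) ↔ ¬ q (w i)) {f : Sym2 V → ℕ}
    (hf : IsProperListEdgeColoring
      (G.deleteEdges (Set.range fun i => s(w i, w (i + 1)))) L f) :
    ∃ h, IsProperListEdgeColoring G L h := by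
  set E : Fin (m + 3) → Sym2 V := fun i => s(w i, w (i + 1)) with hE
  have htwo : (1 : Fin (m + 3)) + 1 ≠ 0 := ne_of_beq_false rfl
  have hEinj : Function.Injective E := by
    intro i j hij
    rcases Sym2.eq_iff.1 hij with ⟨h, -⟩ | ⟨h1, h2⟩
    · exact hw h
    · have h1 := hw h1
      have h2 := hw h2
      rw [h1, add_assoc] at h2
      exact absurd (add_eq_left.1 h2) htwo
  have hdel : ∀ i, (G.deleteEdges (Set.range E)).degree (w i) + 2 ≤ G.degree (w i) := by
    intro i
    have hne : w (i + 1) ≠ w (i - 1) := by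
      intro h
      have := hw h
      rw [eq_sub_iff_add_eq, add_assoc] at this
      exact htwo (add_eq_left.1 this)
    have hprev : E (i - 1) = s(w i, w (i - 1)) := by
      simp [hE, Sym2.eq_swap]
    have hsub : (G.deleteEdges (Set.range E)).neighborFinset (w i) ∪ {w (i + 1), w (i - 1)} ⊆
        G.neighborFinset (w i) := by
      intro x hx
      simp only [Finset.mem_union, SimpleGraph.mem_neighborFinset, SimpleGraph.deleteEdges_adj,
        Finset.mem_insert, Finset.mem_singleton] at hx ⊢
      rcases hx with hx | rfl | rfl
      · exact hx.1
      · exact hadj i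
      · simpa using (hadj (i - 1)).symm
    have hdisj : Disjoint ((G.deleteEdges (Set.range E)).neighborFinset (w i))
        {w (i + 1), w (i - 1)} := by
      rw [Finset.disjoint_left]
      intro x hx hx'
      simp only [SimpleGraph.mem_neighborFinset, SimpleGraph.deleteEdges_adj,
        Finset.mem_insert, Finset.mem_singleton] at hx hx'
      rcases hx' with rfl | rfl
      · exact hx.2 ⟨i, rfl⟩
      · exact hx.2 ⟨i - 1, hprev⟩
    have := Finset.card_le_card hsub
    rwa [Finset.card_union_of_disjoint hdisj, Finset.card_pair hne,
      SimpleGraph.card_neighborFinset_eq_degree, SimpleGraph.card_neighborFinset_eq_degree] at this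
  obtain ⟨c, hc⟩ := exists_cyclic_choice
    (fun i => availableColors (G.deleteEdges (Set.range E)) f (L (E i)) (w i) (w (i + 1)))
    (fun i => by
      have h1 := card_le_card_availableColors (G.deleteEdges (Set.range E)) f (L (E i))
        (w i) (w (i + 1))
      have h2 := hL (E i) (hadj i)
      have h3 := hdel i
      have h4 := hdel (i + 1)
      have h5 := hdeg i
      omega)
    (fun i => q (w i)) hq
  have hg : ∀ i, Function.extend E c 0 (E i) = c i := fun i => hEinj.extend_apply c 0 i
  refine exists_isProperListEdgeColoring_of_deleteEdges (g := Function.extend E c 0) hf ?_ ?_ ?_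
  · rintro _ ⟨i, rfl⟩
    rw [hg]
    exact mem_of_mem_availableColors (hc i).1
  · rintro _ ⟨i, rfl⟩ e' he' hv
    rw [hg]
    exact ne_of_mem_availableColors (hc i).1 he' hv
  · rintro _ ⟨i, rfl⟩ _ ⟨j, rfl⟩ hne ⟨v, hv, hv'⟩
    rw [hg, hg]
    rcases Sym2.mem_iff.1 hv with rfl | rfl <;> rcases Sym2.mem_iff.1 hv' with h | h <;>
      have h := hw h
    · exact absurd (congrArg E h) hne
    · rw [h]
      exact (hc j).2.symm
    · rw [← h]
      exact (hc i).2
    · exact absurd (congrArg E (add_right_cancel h)) hne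

/-- An edge of degree sum at most seven can be colored last from lists of size six. -/
theorem exists_isProperListEdgeColoring_of_edge {V : Type*} [Fintype V] {G : SimpleGraph V}
    {L : Sym2 V → Finset ℕ} (hL : ∀ e ∈ G.edgeSet, 6 ≤ (L e).card) {u v : V} (huv : G.Adj u v)
    (hdeg : G.degree u + G.degree v ≤ 7) {f : Sym2 V → ℕ}
    (hf : IsProperListEdgeColoring (G.deleteEdges {s(u, v)}) L f) :
    ∃ h, IsProperListEdgeColoring G L h := by
  have hdel : ∀ x y, G.Adj x y → s(x, y) = s(u, v) →
      (G.deleteEdges {s(u, v)}).degree x < G.degree x := by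
    intro x y hxy he
    refine Finset.card_lt_card ⟨fun z hz => ?_, fun h => ?_⟩
    · simp only [SimpleGraph.mem_neighborFinset, SimpleGraph.deleteEdges_adj] at hz ⊢
      exact hz.1
    · have := h ((G.mem_neighborFinset x y).2 hxy)
      simp [he] at this
  have h1 := hdel u v huv rfl
  have h2 := hdel v u huv.symm Sym2.eq_swap
  have h3 := card_le_card_availableColors (G.deleteEdges {s(u, v)}) f (L s(u, v)) u v
  have h4 := hL s(u, v) huv
  obtain ⟨c, hc⟩ : (availableColors (G.deleteEdges {s(u, v)}) f (L s(u, v)) u v).Nonempty :=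
    Finset.card_pos.1 (by omega)
  refine exists_isProperListEdgeColoring_of_deleteEdges (g := fun _ => c) hf ?_ ?_ ?_
  · rintro _ rfl
    exact mem_of_mem_availableColors hc
  · rintro _ rfl e' he' hv
    exact ne_of_mem_availableColors hc he' hv
  · rintro _ rfl _ rfl hne
    exact absurd rfl hne

/-- A nonempty forest has fewer edges than non-isolated vertices. -/
theorem SimpleGraph.IsAcyclic.card_edgeFinset_lt_card_support {V : Type*} [Fintype V]
    {G : SimpleGraph V} [Fintype G.edgeSet] [Fintype G.support] (hG : G.IsAcyclic) (hne : G.support.Nonempty) :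
    G.edgeFinset.card < G.support.toFinset.card := by
  have : Nonempty G.support := hne.to_subtype
  obtain ⟨T, hT, -, htree⟩ :=
    SimpleGraph.connected_top.exists_isTree_le_of_le_of_isAcyclic le_top (hG.induce G.support)
  have h1 := htree.card_edgeFinset
  have h2 := Finset.card_le_card (SimpleGraph.edgeFinset_mono hT)
  have h3 := G.card_edgeFinset_induce_support
  have h4 : (SimpleGraph.induce G.support G).edgeFinset.card = G.edgeFinset.card := by
    convert h3
  rw [Set.toFinset_card]
  omega

/-- A nonempty graph of maximum degree at most five and average degree less than four on its
non-isolated vertices has an edge of degree sum at most seven, or a cycle on which vertices of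
degree three and five alternate. -/
theorem exists_light_edge_or_alternating_cycle {V : Type*} [Fintype V] (G : SimpleGraph V)
    (hdeg : ∀ v, G.degree v ≤ 5)
    (havg : ∑ v ∈ G.support.toFinset, G.degree v < 4 * G.support.toFinset.card) :
    (∃ u v, G.Adj u v ∧ G.degree u + G.degree v ≤ 7) ∨
      ∃ (m : ℕ) (w : Fin (m + 3) → V), Function.Injective w ∧ (∀ i, G.Adj (w i) (w (i + 1))) ∧
        (∀ i, G.degree (w i) + G.degree (w (i + 1)) ≤ 8) ∧
        ∀ i, G.degree (w (i + 1)) = 3 ↔ ¬ G.degree (w i) = 3 := by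
  by_cases hlight : ∃ u v, G.Adj u v ∧ G.degree u + G.degree v ≤ 7
  · exact Or.inl hlight
  right
  push Not at hlight
  have hge : ∀ v ∈ G.support, 3 ≤ G.degree v := by
    rintro v ⟨u, huv⟩
    have := hlight v u huv
    have := hdeg u
    omega
  let A : Finset V := Finset.univ.filter fun v => G.degree v = 3
  let B : Finset V := Finset.univ.filter fun v => G.degree v = 5
  have hsupp : ∀ v, 0 < G.degree v → v ∈ G.support := fun v hv =>
    (G.degree_pos_iff_mem_support v).1 hv
  have hcount : B.card < A.card := by
    have hA : A.card = ∑ v ∈ G.support.toFinset, if G.degree v = 3 then 1 else 0 := by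
      rw [← Finset.card_filter]
      congr 1
      ext v
      have := hsupp v
      simp only [A, Finset.mem_filter, Finset.mem_univ, true_and, Set.mem_toFinset]
      exact ⟨fun h => ⟨this (by omega), h⟩, And.right⟩
    have hB : B.card = ∑ v ∈ G.support.toFinset, if G.degree v = 5 then 1 else 0 := by
      rw [← Finset.card_filter]
      congr 1
      ext v
      have := hsupp v
      simp only [B, Finset.mem_filter, Finset.mem_univ, true_and, Set.mem_toFinset]
      exact ⟨fun h => ⟨this (by omega), h⟩, And.right⟩
    have hsum : ∑ v ∈ G.support.toFinset, (G.degree v + if G.degree v = 3 then 1 else 0) =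
        ∑ v ∈ G.support.toFinset, (4 + if G.degree v = 5 then 1 else 0) := by
      refine Finset.sum_congr rfl fun v hv => ?_
      have h1 := hge v (Set.mem_toFinset.1 hv)
      have h2 := hdeg v
      split_ifs <;> omega
    rw [Finset.sum_add_distrib, Finset.sum_add_distrib, ← hA, ← hB, Finset.sum_const,
      smul_eq_mul] at hsum
    omega
  let K : SimpleGraph V :=
    { Adj := fun u v => G.Adj u v ∧ (G.degree u = 3 ∨ G.degree v = 3)
      symm := ⟨fun u v h => ⟨h.1.symm, h.2.symm⟩⟩
      loopless := ⟨fun v h => G.loopless.irrefl v h.1⟩ }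
  have hK : ∀ u v, K.Adj u v → G.degree u = 3 ∧ G.degree v = 5 ∨
      G.degree u = 5 ∧ G.degree v = 3 := by
    rintro u v ⟨h, h'⟩
    have := hlight u v h
    have := hdeg u
    have := hdeg v
    omega
  have hbip : K.IsBipartiteWith (A : Set V) (B : Set V) := by
    refine ⟨?_, fun u v huv => ?_⟩
    · rw [Finset.disjoint_coe, Finset.disjoint_left]
      intro v hv hv'
      simp only [A, B, Finset.mem_filter, Finset.mem_univ, true_and] at hv hv'
      omega
    · simpa [A, B] using hK u v huv
  have hedges : K.edgeFinset.card = 3 * A.card := by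
    rw [← SimpleGraph.isBipartiteWith_sum_degrees_eq_card_edges hbip,
      Finset.sum_const_nat (m := 3), mul_comm]
    intro v hv
    have hv3 : G.degree v = 3 := by simpa [A] using hv
    refine Eq.trans (congrArg Finset.card ?_) hv3
    ext x
    simp [K, hv3]
  have hsub : K.support.toFinset ⊆ A ∪ B := by
    intro v hv
    obtain ⟨u, huv⟩ := Set.mem_toFinset.1 hv
    rcases hK v u huv with h | h <;> simp [A, B, h.1]
  have hcyc : ¬ K.IsAcyclic := by
    intro hac
    obtain ⟨e, he⟩ : K.edgeFinset.Nonempty := Finset.card_pos.1 (by omega)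
    have hne : K.support.Nonempty := by
      induction e with
      | _ u v => exact ⟨u, v, by simpa using he⟩
    have h1 := hac.card_edgeFinset_lt_card_support hne
    have h2 := Finset.card_le_card hsub
    have h3 := Finset.card_union_le A B
    omega
  rw [SimpleGraph.isAcyclic_iff_free_cycleGraph] at hcyc
  push Not at hcyc
  obtain ⟨n, hn, hfree⟩ := hcyc
  obtain ⟨m, rfl⟩ := Nat.exists_eq_add_of_le' hn
  obtain ⟨φ⟩ := hfree
  have hadj : ∀ i, K.Adj (φ i) (φ (i + 1)) := fun i =>
    φ.toHom.map_adj (SimpleGraph.cycleGraph_adj.2 (Or.inr (by simp)))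
  refine ⟨m, φ, φ.injective, fun i => (hadj i).1, fun i => ?_, fun i => ?_⟩ <;>
    · have := hK _ _ (hadj i)
      omega

/-- A bound on the average degree passes to the non-isolated part of every spanning subgraph. -/
theorem MadLT.sum_degree_lt {V : Type*} [Fintype V] {G H : SimpleGraph V} (hG : MadLT G 4)
    (hHG : H ≤ G) (hne : H.support.Nonempty) :
    ∑ v ∈ H.support.toFinset, H.degree v < 4 * H.support.toFinset.card := by
  obtain ⟨K, hverts, hadj⟩ : ∃ K : G.Subgraph, K.verts = H.support ∧ K.Adj = H.Adj :=
    ⟨{ verts := H.support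
       Adj := H.Adj
       adj_sub := fun h => hHG h
       edge_vert := fun h => ⟨_, h⟩
       symm := H.symm }, rfl, rfl⟩
  have hKne : K.verts.Nonempty := hverts ▸ hne
  have h := hG K hKne
  rw [div_lt_iff₀ (Nat.cast_pos.2 (Finset.card_pos.2 (Set.toFinset_nonempty.2 hKne)))] at h
  have hdeg : ∀ v, (K.neighborSet v).ncard = H.degree v := by
    intro v
    have : K.neighborSet v = H.neighborSet v := by
      ext x
      simp [SimpleGraph.Subgraph.mem_neighborSet, hadj]
    rw [this, ← SimpleGraph.card_neighborSet_eq_degree, ← Nat.card_eq_fintype_card]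
    rfl
  simp only [hdeg] at h
  norm_cast at h
  convert h using 2
  · exact Finset.ext fun x => by simp [hverts]
  · exact congrArg Finset.card (Finset.ext fun x => by simp [hverts])

/-- Every graph of maximum degree at most five and maximum average degree less than four is
`6`-list-edge-colorable. -/
theorem MadLT.listEdgeColorable {V : Type*} [Fintype V] {G : SimpleGraph V} (hG : MadLT G 4)
    (hdeg : ∀ v, G.degree v ≤ 5) : ListEdgeColorable G 6 := by
  intro L hL
  suffices ∀ n, ∀ H ≤ G, H.edgeSet.ncard = n → ∃ f, IsProperListEdgeColoring H L f from
    this _ G le_rfl rfl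
  intro n
  induction n using Nat.strong_induction_on with
  | _ n ih =>
    rintro H hHG rfl
    have hLH : ∀ e ∈ H.edgeSet, 6 ≤ (L e).card := fun e he =>
      hL e (SimpleGraph.edgeSet_mono hHG he)
    have hdel : ∀ (S : Set (Sym2 V)) (u v : V), H.Adj u v → s(u, v) ∈ S →
        ∃ f, IsProperListEdgeColoring (H.deleteEdges S) L f := by
      intro S u v huv hS
      refine ih _ ?_ _ ((H.deleteEdges_le S).trans hHG) rfl
      refine Set.ncard_lt_ncard (SimpleGraph.edgeSet_ssubset_edgeSet.2 ?_)
      refine lt_of_le_of_ne (H.deleteEdges_le S) fun h => ?_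
      rw [← h] at huv
      exact (SimpleGraph.deleteEdges_adj.1 huv).2 hS
    by_cases hne : H.support.Nonempty
    · have hdegH : ∀ v, H.degree v ≤ 5 := fun v =>
        (SimpleGraph.degree_le_of_le hHG).trans (hdeg v)
      rcases exists_light_edge_or_alternating_cycle H hdegH (hG.sum_degree_lt hHG hne) with
        ⟨u, v, huv, hd⟩ | ⟨m, w, hw, hadj, hd, hq⟩
      · obtain ⟨f, hf⟩ := hdel {s(u, v)} u v huv rfl
        exact exists_isProperListEdgeColoring_of_edge hLH huv hd hf
      · obtain ⟨f, hf⟩ := hdel (Set.range fun i => s(w i, w (i + 1))) _ _ (hadj 0) ⟨0, rfl⟩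
        exact exists_isProperListEdgeColoring_of_cycle hLH hw hadj hd
          (q := fun v => H.degree v = 3) hq hf
    · have hempty : ∀ e, e ∉ H.edgeSet := by
        intro e he
        induction e with
        | _ u v => exact hne ⟨u, v, he⟩
      exact ⟨0, fun e he => absurd he (hempty e), fun e he => absurd he (hempty e)⟩

theorem stmt_7 {V : Type*} [Fintype V] (G : SimpleGraph V) [DecidableRel G.Adj]
    (hΔ : G.maxDegree = 5) (hmad : MadLT G 4) :
    listChromaticIndex G ≤ 6 := by
  refine Nat.sInf_le (hmad.listEdgeColorable fun v => ?_)
  rw [← hΔ]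
  convert G.degree_le_maxDegree v
end

section
/- If G is a finite simple graph with maximum degree Δ = 6 and mad(G) < 14/3, then χ'_ℓ(G) ≤ 7. -/
open scoped Classical

/-- Stable matching: `l` and `r` send an edge to its two ends, left ends prefer large values of `c`
and right ends small ones. -/
theorem exists_stable_matching_s8 {E A B : Type*} (l : E → A) (r : E → B) (c : E → ℤ)
    (S : Finset E)
    (hc : ∀ e ∈ S, ∀ f ∈ S, e ≠ f → (l e = l f ∨ r e = r f) → c e ≠ c f) :
    ∃ M ⊆ S, (∀ e ∈ M, ∀ f ∈ M, e ≠ f → l e ≠ l f ∧ r e ≠ r f) ∧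
      ∀ e ∈ S, e ∉ M → ∃ m ∈ M, (l m = l e ∧ c e < c m) ∨ (r m = r e ∧ c m < c e) := by
  induction S using Finset.strongInduction with
  | H S ih =>
  by_cases h : ∃ e ∈ S, (∀ f ∈ S, l f = l e → c f ≤ c e) ∧ ∃ e' ∈ S, r e = r e' ∧ c e < c e'
  · obtain ⟨e, he, htop, e', he', hr, hlt⟩ := h
    obtain ⟨M, hMS, hM, hdom⟩ := ih (S.erase e') (Finset.erase_ssubset he')
      (fun x hx y hy => hc x (Finset.mem_of_mem_erase hx) y (Finset.mem_of_mem_erase hy))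
    refine ⟨M, hMS.trans (Finset.erase_subset _ _), hM, fun x hx hxM => ?_⟩
    by_cases hxe : x = e'
    · subst hxe
      by_cases heM : e ∈ M
      · exact ⟨e, heM, Or.inr ⟨hr, hlt⟩⟩
      · obtain ⟨m, hm, h1 | h1⟩ := hdom e (Finset.mem_erase.2 ⟨by grind, he⟩) heM
        · have := htop m (Finset.mem_of_mem_erase (hMS hm)) h1.1
          omega
        · exact ⟨m, hm, Or.inr ⟨h1.1.trans hr, by omega⟩⟩
    · exact hdom x (Finset.mem_erase.2 ⟨hxe, hx⟩) hxM
  · push Not at h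
    refine ⟨S.filter (fun e => ∀ f ∈ S, l f = l e → c f ≤ c e), Finset.filter_subset _ _, ?_, ?_⟩
    · intro e he f hf hef
      rw [Finset.mem_filter] at he hf
      refine ⟨fun hl => ?_, fun hr => ?_⟩
      · exact hc e he.1 f hf.1 hef (Or.inl hl)
          (le_antisymm (hf.2 e he.1 hl) (he.2 f hf.1 hl.symm))
      · exact hc e he.1 f hf.1 hef (Or.inr hr)
          (le_antisymm (h f hf.1 hf.2 e he.1 hr.symm) (h e he.1 he.2 f hf.1 hr))
    · intro e he heM
      obtain ⟨m, hm, hmax⟩ := (S.filter (fun f => l f = l e)).exists_max_image c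
        ⟨e, Finset.mem_filter.2 ⟨he, rfl⟩⟩
      rw [Finset.mem_filter] at hm
      have hmM : m ∈ S.filter (fun e => ∀ f ∈ S, l f = l e → c f ≤ c e) :=
        Finset.mem_filter.2 ⟨hm.1, fun f hf hfl =>
          hmax f (Finset.mem_filter.2 ⟨hf, hfl.trans hm.2⟩)⟩
      refine ⟨m, hmM, Or.inl ⟨hm.2, lt_of_le_of_ne (hmax e (Finset.mem_filter.2 ⟨he, rfl⟩)) ?_⟩⟩
      exact hc e he m hm.1 (fun h => heM (h ▸ hmM)) (Or.inl hm.2.symm)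

/-- Galvin's kernel argument: a bipartite multigraph is colorable from lists that are longer than the
number of neighboring edges preferred to the given one. -/
theorem exists_list_coloring_of_preferences_s8 {E A B : Type*} (l : E → A) (r : E → B) (c : E → ℤ)
    (F : Finset E) (L : E → Finset ℕ)
    (hc : ∀ e ∈ F, ∀ f ∈ F, e ≠ f → (l e = l f ∨ r e = r f) → c e ≠ c f)
    (hL : ∀ e ∈ F, (F.filter (fun f => l f = l e ∧ c e < c f)).card +
      (F.filter (fun f => r f = r e ∧ c f < c e)).card < (L e).card) :
    ∃ φ : E → ℕ, (∀ e ∈ F, φ e ∈ L e) ∧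
      ∀ e ∈ F, ∀ f ∈ F, e ≠ f → (l e = l f ∨ r e = r f) → φ e ≠ φ f := by
  induction F using Finset.strongInduction generalizing L with
  | H F ih =>
  obtain rfl | ⟨e₀, he₀⟩ := F.eq_empty_or_nonempty
  · exact ⟨fun _ => 0, by simp, by simp⟩
  obtain ⟨a, ha⟩ : (L e₀).Nonempty := Finset.card_pos.1 ((Nat.zero_le _).trans_lt (hL e₀ he₀))
  obtain ⟨M, hMS, hM, hdom⟩ := exists_stable_matching_s8 l r c (F.filter (fun e => a ∈ L e))
    (fun x hx y hy => hc x (Finset.mem_filter.1 hx).1 y (Finset.mem_filter.1 hy).1)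
  have hMF : M ⊆ F := hMS.trans (Finset.filter_subset _ _)
  have hMne : M.Nonempty := by
    by_cases h : e₀ ∈ M
    · exact ⟨e₀, h⟩
    · obtain ⟨m, hm, -⟩ := hdom e₀ (Finset.mem_filter.2 ⟨he₀, ha⟩) h
      exact ⟨m, hm⟩
  have hsub : F \ M ⊆ F := Finset.sdiff_subset
  obtain ⟨φ, hφL, hφ⟩ := ih (F \ M) (Finset.sdiff_ssubset hMF hMne) (fun e => (L e).erase a)
    (fun x hx y hy => hc x (hsub hx) y (hsub hy)) (by
      intro e he
      obtain ⟨heF, heM⟩ := Finset.mem_sdiff.1 he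
      have h0 := hL e heF
      have h1 : ((F \ M).filter (fun f => l f = l e ∧ c e < c f)) ⊆
        (F.filter (fun f => l f = l e ∧ c e < c f)) := Finset.filter_subset_filter _ hsub
      have h2 : ((F \ M).filter (fun f => r f = r e ∧ c f < c e)) ⊆
        (F.filter (fun f => r f = r e ∧ c f < c e)) := Finset.filter_subset_filter _ hsub
      have h1' := Finset.card_le_card h1
      have h2' := Finset.card_le_card h2
      by_cases hae : a ∈ L e
      · rw [Finset.card_erase_of_mem hae]
        obtain ⟨m, hm, hd | hd⟩ := hdom e (Finset.mem_filter.2 ⟨heF, hae⟩) heM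
        · have := Finset.card_lt_card (Finset.ssubset_iff_subset_ne.2 ⟨h1, fun h => by
            have : m ∈ F.filter (fun f => l f = l e ∧ c e < c f) :=
              Finset.mem_filter.2 ⟨hMF hm, hd⟩
            rw [← h] at this
            simp [hm] at this⟩)
          omega
        · have := Finset.card_lt_card (Finset.ssubset_iff_subset_ne.2 ⟨h2, fun h => by
            have : m ∈ F.filter (fun f => r f = r e ∧ c f < c e) :=
              Finset.mem_filter.2 ⟨hMF hm, hd⟩
            rw [← h] at this
            simp [hm] at this⟩)
          omega
      · rw [Finset.erase_eq_of_notMem hae]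
        omega)
  refine ⟨fun e => if e ∈ M then a else φ e, fun e he => ?_, fun e he f hf hef hadj => ?_⟩
  · by_cases heM : e ∈ M
    · simpa [heM] using (Finset.mem_filter.1 (hMS heM)).2
    · simpa [heM] using Finset.mem_of_mem_erase (hφL e (Finset.mem_sdiff.2 ⟨he, heM⟩))
  · by_cases heM : e ∈ M <;> by_cases hfM : f ∈ M
    · have := hM e heM f hfM hef
      tauto
    · simpa [heM, hfM] using (Finset.ne_of_mem_erase (hφL f (Finset.mem_sdiff.2 ⟨hf, hfM⟩))).symm
    · simpa [heM, hfM] using Finset.ne_of_mem_erase (hφL e (Finset.mem_sdiff.2 ⟨he, heM⟩))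
    · simpa [heM, hfM] using hφ e (Finset.mem_sdiff.2 ⟨he, heM⟩) f
        (Finset.mem_sdiff.2 ⟨hf, hfM⟩) hef hadj

/-- The number of edges in `F` sharing with `e` the end given by `l`. -/
noncomputable def fiberCard {E A : Type*} (l : E → A) (F : Finset E) (e : E) : ℕ :=
  (F.filter (fun f => l f = l e)).card

theorem fiberCard_congr {E A : Type*} (l : E → A) (F : Finset E) {e f : E} (h : l e = l f) :
    fiberCard l F e = fiberCard l F f := by
  simp [fiberCard, h]

theorem exists_matching_of_card_le {E A B : Type*} (l : E → A) (r : E → B) (F : Finset E) (D : ℕ)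
    (hl : ∀ e ∈ F, fiberCard l F e ≤ D)
    (hD : ∃ e ∈ F, fiberCard l F e = D ∨ fiberCard r F e = D)
    (hcard : ((F.filter (fun e => fiberCard l F e = D)).image l).card ≤
      ((F.filter (fun e => fiberCard r F e = D)).image r).card) :
    ∃ M ⊆ F, M.Nonempty ∧ (∀ e ∈ M, ∀ f ∈ M, e ≠ f → l e ≠ l f ∧ r e ≠ r f) ∧
      ∀ e ∈ F, (∃ m ∈ M, r m = r e) →
        (∃ m ∈ M, l m = l e) ∨ fiberCard l F e < fiberCard r F e := by
  set W := (F.filter (fun e => fiberCard r F e = D)).image r with hW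
  let N : Finset B → Finset A :=
    fun S => (F.filter (fun e => r e ∈ S ∧ fiberCard l F e = D)).image l
  have hNmono : ∀ S T, S ⊆ T → N S ⊆ N T := fun S T h =>
    Finset.image_subset_image (fun e he => by
      simp only [Finset.mem_filter] at he ⊢
      exact ⟨he.1, h he.2.1, he.2.2⟩)
  have hWne : W.Nonempty := by
    obtain ⟨e, he, h | h⟩ := hD
    · refine Finset.card_pos.1 (lt_of_lt_of_le (Finset.card_pos.2 ⟨l e, ?_⟩) hcard)
      exact Finset.mem_image_of_mem _ (Finset.mem_filter.2 ⟨he, h⟩)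
    · exact ⟨r e, Finset.mem_image_of_mem _ (Finset.mem_filter.2 ⟨he, h⟩)⟩
  obtain ⟨S, hS, hmin⟩ := (W.powerset.filter
    (fun S => S.Nonempty ∧ (N S).card ≤ S.card)).exists_min_image Finset.card ⟨W, by
      refine Finset.mem_filter.2 ⟨Finset.mem_powerset_self _, hWne, le_trans ?_ hcard⟩
      refine Finset.card_le_card (Finset.image_subset_image fun e he => ?_)
      simp only [Finset.mem_filter] at he ⊢
      exact ⟨he.1, he.2.2⟩⟩
  simp only [Finset.mem_filter, Finset.mem_powerset] at hS hmin
  obtain ⟨hSW, hSne, hNS⟩ := hS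
  have hSD : ∀ e, r e ∈ S → fiberCard r F e = D := by
    intro e he
    obtain ⟨f, hf, hfe⟩ := Finset.mem_image.1 (hSW he)
    rw [← fiberCard_congr r F hfe]
    exact (Finset.mem_filter.1 hf).2
  by_cases hiso : ∃ w ∈ S, N {w} = ∅
  · obtain ⟨w, hw, hNw⟩ := hiso
    obtain ⟨e, he, rfl⟩ := Finset.mem_image.1 (hSW hw)
    refine ⟨{e}, by simpa using (Finset.mem_filter.1 he).1, by simp, by simp, ?_⟩
    rintro f hf ⟨m, hm, hmf⟩
    rw [Finset.mem_singleton] at hm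
    subst hm
    right
    rw [hSD f (hmf ▸ hw)]
    refine lt_of_le_of_ne (hl f hf) fun h => ?_
    have : l f ∈ N {r m} := Finset.mem_image_of_mem _
      (Finset.mem_filter.2 ⟨hf, by simp [hmf], h⟩)
    simp [hNw] at this
  · push Not at hiso
    have hall : ∀ s : Finset S, s.card ≤ (s.biUnion (fun w => N {w.1})).card := by
      intro s
      have hbi : s.biUnion (fun w => N {w.1}) = N (s.map (Function.Embedding.subtype _)) := by
        ext x
        simp only [N, Finset.mem_biUnion, Finset.mem_image, Finset.mem_filter,
          Finset.mem_singleton, Finset.mem_map, Function.Embedding.subtype_apply]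
        constructor
        · rintro ⟨w, hw, e, ⟨he, hr, hd⟩, hx⟩
          exact ⟨e, ⟨he, ⟨w, hw, hr.symm⟩, hd⟩, hx⟩
        · rintro ⟨e, ⟨he, ⟨w, hw, hr⟩, hd⟩, hx⟩
          exact ⟨w, hw, e, ⟨he, hr.symm, hd⟩, hx⟩
      have hsS : s.map (Function.Embedding.subtype _) ⊆ S := by
        intro x hx
        obtain ⟨w, -, rfl⟩ := Finset.mem_map.1 hx
        exact w.2
      rw [hbi, ← Finset.card_map (Function.Embedding.subtype _)]
      generalize s.map (Function.Embedding.subtype _) = T at hsS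
      by_contra! hlt
      obtain ⟨w, hw⟩ : T.Nonempty := Finset.card_pos.1 (by omega)
      have hTe := Finset.card_erase_of_mem hw
      have hN := Finset.card_le_card (hNmono (T.erase w) T (Finset.erase_subset _ _))
      have hTS := Finset.card_le_card hsS
      by_cases hne : (T.erase w).Nonempty
      · have := hmin (T.erase w) ⟨((Finset.erase_subset _ _).trans hsS).trans hSW, hne, by omega⟩
        omega
      · rw [Finset.not_nonempty_iff_eq_empty] at hne
        rw [hne, Finset.card_empty] at hTe
        have hNw := Finset.card_le_card (hNmono {w} T (by simpa using hw))
        have := Finset.card_pos.2 (hiso w (hsS hw))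
        omega
    obtain ⟨f, hfinj, hf⟩ :=
      (Finset.all_card_le_biUnion_card_iff_exists_injective (fun w : S => N {w.1})).1 hall
    have hex : ∀ w : S, ∃ e ∈ F, r e = w.1 ∧ l e = f w := by
      intro w
      obtain ⟨e, he, hle⟩ := Finset.mem_image.1 (hf w)
      simp only [Finset.mem_filter, Finset.mem_singleton] at he
      exact ⟨e, he.1, he.2.1, hle⟩
    choose g hgF hgr hgl using hex
    have himg : Finset.univ.image f = N S := by
      refine Finset.eq_of_subset_of_card_le ?_ ?_
      · intro x hx
        obtain ⟨w, -, rfl⟩ := Finset.mem_image.1 hx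
        exact hNmono {w.1} S (by simp) (hf w)
      · rw [Finset.card_image_of_injective _ hfinj]
        simpa using hNS
    refine ⟨Finset.univ.image g, ?_, ?_, ?_, ?_⟩
    · intro x hx
      obtain ⟨w, -, rfl⟩ := Finset.mem_image.1 hx
      exact hgF w
    · obtain ⟨w, hw⟩ := hSne
      exact ⟨g ⟨w, hw⟩, Finset.mem_image_of_mem _ (Finset.mem_univ _)⟩
    · intro x hx y hy hxy
      obtain ⟨w, -, rfl⟩ := Finset.mem_image.1 hx
      obtain ⟨v, -, rfl⟩ := Finset.mem_image.1 hy
      have hwv : w ≠ v := fun h => hxy (h ▸ rfl)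
      rw [hgr, hgr, hgl, hgl]
      exact ⟨fun h => hwv (hfinj h), fun h => hwv (Subtype.ext h)⟩
    · rintro e he ⟨m, hm, hme⟩
      obtain ⟨w, -, rfl⟩ := Finset.mem_image.1 hm
      have heS : r e ∈ S := by rw [← hme, hgr]; exact w.2
      by_cases hd : fiberCard l F e = D
      · left
        have : l e ∈ N S := Finset.mem_image_of_mem _ (Finset.mem_filter.2 ⟨he, heS, hd⟩)
        rw [← himg] at this
        obtain ⟨v, -, hv⟩ := Finset.mem_image.1 this
        exact ⟨g v, Finset.mem_image_of_mem _ (Finset.mem_univ _), (hgl v).trans hv⟩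
      · right
        rw [hSD e heS]
        exact lt_of_le_of_ne (hl e he) hd

/-- The numbering `c` is injective at every vertex, and it ranks fewer than
`max (fiberCard l F e) (fiberCard r F e)` neighbors of `e` as preferable to `e`. -/
def IsPreference {E A B : Type*} (l : E → A) (r : E → B) (F : Finset E) (c : E → ℤ) : Prop :=
  (∀ e ∈ F, ∀ f ∈ F, e ≠ f → (l e = l f ∨ r e = r f) → c e ≠ c f) ∧
    ∀ e ∈ F, (F.filter (fun f => l f = l e ∧ c e < c f)).card +
      (F.filter (fun f => r f = r e ∧ c f < c e)).card < max (fiberCard l F e) (fiberCard r F e)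

theorem IsPreference.swap {E A B : Type*} {l : E → A} {r : E → B} {F : Finset E} {c : E → ℤ}
    (h : IsPreference l r F c) : IsPreference r l F (fun e => -c e) := by
  refine ⟨fun e he f hf hef hadj => ?_, fun e he => ?_⟩
  · simpa using h.1 e he f hf hef hadj.symm
  · simpa [add_comm, max_comm] using h.2 e he

theorem fiberCard_sdiff {E A : Type*} (l : E → A) {F M : Finset E} (hMF : M ⊆ F)
    (hM : ∀ e ∈ M, ∀ f ∈ M, e ≠ f → l e ≠ l f) (e : E) :
    fiberCard l F e = fiberCard l (F \ M) e + if ∃ m ∈ M, l m = l e then 1 else 0 := by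
  have h1 : fiberCard l F e = fiberCard l (F \ M) e + fiberCard l M e := by
    unfold fiberCard
    rw [← Finset.card_union_of_disjoint
      (Finset.disjoint_filter_filter Finset.sdiff_disjoint), ← Finset.filter_union,
      Finset.sdiff_union_of_subset hMF]
  rw [h1]
  congr 1
  unfold fiberCard
  split_ifs with h
  · obtain ⟨m, hm, hme⟩ := h
    rw [Finset.card_eq_one]
    refine ⟨m, ?_⟩
    ext x
    simp only [Finset.mem_filter, Finset.mem_singleton]
    constructor
    · rintro ⟨hx, hxe⟩
      by_contra hne
      exact hM x hx m hm hne (hxe.trans hme.symm)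
    · rintro rfl
      exact ⟨hm, hme⟩
  · push Not at h
    rw [Finset.card_eq_zero, Finset.filter_eq_empty_iff]
    exact h

theorem IsPreference.extend {E A B : Type*} {l : E → A} {r : E → B} {F M : Finset E} {c : E → ℤ}
    (hMF : M ⊆ F) (hM : ∀ e ∈ M, ∀ f ∈ M, e ≠ f → l e ≠ l f ∧ r e ≠ r f)
    (hcov : ∀ e ∈ F, (∃ m ∈ M, r m = r e) →
      (∃ m ∈ M, l m = l e) ∨ fiberCard l F e < fiberCard r F e)
    (h : IsPreference l r (F \ M) c) : ∃ c', IsPreference l r F c' := by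
  obtain ⟨b, hb⟩ : ∃ b : ℤ, ∀ e ∈ F, b < c e := by
    obtain ⟨b, hb⟩ := (F.image c).bddBelow
    exact ⟨b - 1, fun e he => by
      have := hb (Finset.mem_coe.2 (Finset.mem_image_of_mem c he))
      omega⟩
  have hout : ∀ {e}, e ∈ F → e ∉ M → e ∈ F \ M := fun h h' => Finset.mem_sdiff.2 ⟨h, h'⟩
  refine ⟨fun e => if e ∈ M then b else c e, fun e he f hf hef hadj => ?_, fun e he => ?_⟩
  · by_cases heM : e ∈ M <;> by_cases hfM : f ∈ M
    · have := hM e heM f hfM hef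
      tauto
    · simpa [heM, hfM] using (hb f hf).ne
    · simpa [heM, hfM] using (hb e he).ne'
    · simpa [heM, hfM] using h.1 e (hout he heM) f (hout hf hfM) hef hadj
  · by_cases heM : e ∈ M
    · simp only [heM, if_true]
      have h2 : (F.filter (fun f => r f = r e ∧ (if f ∈ M then b else c f) < b)).card = 0 := by
        rw [Finset.card_eq_zero, Finset.filter_eq_empty_iff]
        rintro f hf ⟨-, hlt⟩
        have := hb f hf
        split_ifs at hlt <;> omega
      have h1 : (F.filter (fun f => l f = l e ∧ b < if f ∈ M then b else c f)).card <
          fiberCard l F e := by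
        refine Finset.card_lt_card (Finset.ssubset_iff_subset_ne.2 ⟨?_, fun h => ?_⟩)
        · intro f hf
          simp only [Finset.mem_filter] at hf ⊢
          exact ⟨hf.1, hf.2.1⟩
        · have : e ∈ F.filter (fun f => l f = l e) := Finset.mem_filter.2 ⟨he, rfl⟩
          rw [← h] at this
          simp [heM] at this
      rw [h2, add_zero]
      exact lt_of_lt_of_le h1 (le_max_left _ _)
    · simp only [heM, if_false]
      have h1 : (F.filter (fun f => l f = l e ∧ c e < if f ∈ M then b else c f)) =
          ((F \ M).filter (fun f => l f = l e ∧ c e < c f)) := by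
        ext f
        have := hb e he
        simp only [Finset.mem_filter, Finset.mem_sdiff]
        by_cases hfM : f ∈ M
        · simp only [hfM, if_true]
          constructor
          · rintro ⟨-, -, h⟩
            omega
          · tauto
        · simp [hfM]
      have h2 : (F.filter (fun f => r f = r e ∧ (if f ∈ M then b else c f) < c e)).card ≤
          ((F \ M).filter (fun f => r f = r e ∧ c f < c e)).card + fiberCard r M e := by
        refine le_trans (Finset.card_le_card ?_) (Finset.card_union_le _ _)
        intro f hf
        simp only [Finset.mem_filter, Finset.mem_union, Finset.mem_sdiff] at hf ⊢
        by_cases hfM : f ∈ M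
        · exact Or.inr ⟨hfM, hf.2.1⟩
        · simp only [hfM, if_false] at hf
          exact Or.inl ⟨⟨hf.1, hfM⟩, hf.2⟩
      have h3 := fiberCard_sdiff r (subset_refl M) (fun x hx y hy hxy => (hM x hx y hy hxy).2) e
      have h4 := fiberCard_sdiff r hMF (fun x hx y hy hxy => (hM x hx y hy hxy).2) e
      have h5 := fiberCard_sdiff l hMF (fun x hx y hy hxy => (hM x hx y hy hxy).1) e
      have h6 : fiberCard r (M \ M) e = 0 := by simp [fiberCard]
      have h7 := h.2 e (hout he heM)
      have h8 := hcov e he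
      rw [h1]
      by_cases hr : ∃ m ∈ M, r m = r e
      · specialize h8 hr
        rw [if_pos hr] at h3 h4
        by_cases hl : ∃ m ∈ M, l m = l e
        · rw [if_pos hl] at h5
          omega
        · rw [if_neg hl] at h5
          have := h8.resolve_left hl
          omega
      · rw [if_neg hr] at h3 h4
        omega

/-- The orientation behind the Borodin–Kostochka–Woodall theorem. -/
theorem exists_isPreference {E A B : Type*} (l : E → A) (r : E → B) (F : Finset E) :
    ∃ c, IsPreference l r F c := by
  induction F using Finset.strongInduction with
  | H F ih =>
  obtain rfl | hne := F.eq_empty_or_nonempty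
  · exact ⟨fun _ => 0, by simp [IsPreference]⟩
  obtain ⟨e₀, he₀, hmax⟩ :=
    F.exists_max_image (fun e => max (fiberCard l F e) (fiberCard r F e)) hne
  set D := max (fiberCard l F e₀) (fiberCard r F e₀) with hDdef
  have hD : fiberCard l F e₀ = D ∨ fiberCard r F e₀ = D := by omega
  have hl : ∀ e ∈ F, fiberCard l F e ≤ D := fun e he => (le_max_left _ _).trans (hmax e he)
  have hr : ∀ e ∈ F, fiberCard r F e ≤ D := fun e he => (le_max_right _ _).trans (hmax e he)
  obtain hle | hle := le_total
    ((F.filter (fun e => fiberCard l F e = D)).image l).card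
    ((F.filter (fun e => fiberCard r F e = D)).image r).card
  · obtain ⟨M, hMF, hMne, hM, hcov⟩ := exists_matching_of_card_le l r F D hl ⟨e₀, he₀, hD⟩ hle
    obtain ⟨c, hc⟩ := ih (F \ M) (Finset.sdiff_ssubset hMF hMne)
    exact hc.extend hMF hM hcov
  · obtain ⟨M, hMF, hMne, hM, hcov⟩ :=
      exists_matching_of_card_le r l F D hr ⟨e₀, he₀, hD.symm⟩ hle
    obtain ⟨c, hc⟩ := ih (F \ M) (Finset.sdiff_ssubset hMF hMne)
    obtain ⟨c', hc'⟩ := hc.swap.extend hMF hM hcov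
    exact ⟨_, hc'.swap⟩

/-- The Borodin–Kostochka–Woodall theorem: a bipartite multigraph is colorable from lists such that
the list of each edge is at least as long as the degrees of both of its ends. -/
theorem exists_list_coloring_of_fiberCard_le {E A B : Type*} (l : E → A) (r : E → B)
    (F : Finset E) (L : E → Finset ℕ)
    (hL : ∀ e ∈ F, max (fiberCard l F e) (fiberCard r F e) ≤ (L e).card) :
    ∃ φ : E → ℕ, (∀ e ∈ F, φ e ∈ L e) ∧
      ∀ e ∈ F, ∀ f ∈ F, e ≠ f → (l e = l f ∨ r e = r f) → φ e ≠ φ f := by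
  obtain ⟨c, hc⟩ := exists_isPreference l r F
  exact exists_list_coloring_of_preferences_s8 l r c F L hc.1
    (fun e he => (hc.2 e he).trans_le (hL e he))

/-- The neighbors of `v` in `G`, as a finset independent of decidability instances. -/
noncomputable def nbrs {V : Type*} [Fintype V] (G : SimpleGraph V) (v : V) : Finset V :=
  Finset.univ.filter (G.Adj v)

@[simp]
theorem mem_nbrs {V : Type*} [Fintype V] {G : SimpleGraph V} {v w : V} :
    w ∈ nbrs G v ↔ G.Adj v w := by
  simp [nbrs]

theorem card_filter_adj_deleteEdges {V : Type*} [Fintype V] (G : SimpleGraph V)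
    (F : Finset (V × V)) (hF : ∀ e ∈ F, G.Adj e.1 e.2) (v : V) :
    (nbrs (G.deleteEdges ((fun e => s(e.1, e.2)) '' (F : Set (V × V)))) v).card +
        (F.filter (fun e => e.1 = v)).card ≤ (nbrs G v).card ∧
    (nbrs (G.deleteEdges ((fun e => s(e.1, e.2)) '' (F : Set (V × V)))) v).card +
        (F.filter (fun e => e.2 = v)).card ≤ (nbrs G v).card := by
  constructor
  · rw [← Finset.card_image_of_injOn (s := F.filter (fun e => e.1 = v)) (f := Prod.snd),
      ← Finset.card_union_of_disjoint]
    · refine Finset.card_le_card fun w hw => ?_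
      simp only [Finset.mem_union, Finset.mem_filter, mem_nbrs, Finset.mem_image,
        SimpleGraph.deleteEdges_adj] at hw ⊢
      obtain hw | ⟨e, ⟨he, rfl⟩, rfl⟩ := hw
      · exact hw.1
      · exact hF e he
    · rw [Finset.disjoint_left]
      intro w hw hw'
      simp only [Finset.mem_filter, mem_nbrs, Finset.mem_image,
        SimpleGraph.deleteEdges_adj] at hw hw'
      obtain ⟨e, ⟨he, rfl⟩, rfl⟩ := hw'
      exact hw.2 ⟨e, he, rfl⟩
    · intro e he f hf hef
      simp only [Finset.coe_filter, Set.mem_ofPred_eq] at he hf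
      exact Prod.ext (he.2.trans hf.2.symm) hef
  · rw [← Finset.card_image_of_injOn (s := F.filter (fun e => e.2 = v)) (f := Prod.fst),
      ← Finset.card_union_of_disjoint]
    · refine Finset.card_le_card fun w hw => ?_
      simp only [Finset.mem_union, Finset.mem_filter, mem_nbrs, Finset.mem_image,
        SimpleGraph.deleteEdges_adj] at hw ⊢
      obtain hw | ⟨e, ⟨he, rfl⟩, rfl⟩ := hw
      · exact hw.1
      · exact (hF e he).symm
    · rw [Finset.disjoint_left]
      intro w hw hw'
      simp only [Finset.mem_filter, mem_nbrs, Finset.mem_image,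
        SimpleGraph.deleteEdges_adj] at hw hw'
      obtain ⟨e, ⟨he, rfl⟩, rfl⟩ := hw'
      exact hw.2 ⟨e, he, Sym2.eq_swap⟩
    · intro e he f hf hef
      simp only [Finset.coe_filter, Set.mem_ofPred_eq] at he hf
      exact Prod.ext hef (he.2.trans hf.2.symm)

/-- A list edge-coloring extends to a bipartite set `F` of removed edges when every edge of `F` has
few neighbors outside `F`. -/
theorem IsProperListEdgeColoring.exists_extension {V : Type*} [Fintype V] {G : SimpleGraph V}
    {L : Sym2 V → Finset ℕ} {k : ℕ} (hL : ∀ e ∈ G.edgeSet, k ≤ (L e).card)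
    {F : Finset (V × V)} (hF : ∀ e ∈ F, G.Adj e.1 e.2)
    (hdisj : ∀ e ∈ F, ∀ f ∈ F, e.1 ≠ f.2)
    (hdeg : ∀ e ∈ F, (nbrs G e.1).card +
      (nbrs G e.2).card ≤
        k + min (fiberCard Prod.fst F e) (fiberCard Prod.snd F e))
    {g : Sym2 V → ℕ}
    (hg : IsProperListEdgeColoring
      (G.deleteEdges ((fun e => s(e.1, e.2)) '' (F : Set (V × V)))) L g) :
    ∃ f, IsProperListEdgeColoring G L f := by
  set H := G.deleteEdges ((fun e => s(e.1, e.2)) '' (F : Set (V × V))) with hH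
  let N : V → Finset ℕ := fun v => (nbrs H v).image (fun w => g s(v, w))
  have hN : ∀ v, (N v).card ≤ (nbrs H v).card :=
    fun v => Finset.card_image_le
  obtain ⟨φ, hφL, hφ⟩ := exists_list_coloring_of_fiberCard_le Prod.fst Prod.snd F
    (fun e => L s(e.1, e.2) \ (N e.1 ∪ N e.2)) (by
      intro e he
      have h1 := Finset.le_card_sdiff (N e.1 ∪ N e.2) (L s(e.1, e.2))
      have h2 := Finset.card_union_le (N e.1) (N e.2)
      have h3 := hL s(e.1, e.2) (hF e he)
      have h4 := (card_filter_adj_deleteEdges G F hF e.1).1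
      have h5 := (card_filter_adj_deleteEdges G F hF e.2).2
      rw [← hH] at h4 h5
      have h6 := hN e.1
      have h7 := hN e.2
      have h8 := hdeg e he
      simp only [fiberCard] at h8 ⊢
      omega)
  have huniq : ∀ e ∈ F, ∀ f ∈ F, s(e.1, e.2) = s(f.1, f.2) → e = f := by
    intro e he f hf h
    rw [Sym2.eq_iff] at h
    obtain h | h := h
    · exact Prod.ext h.1 h.2
    · exact absurd h.1 (hdisj e he f hf)
  let f : Sym2 V → ℕ := fun x => if h : ∃ e ∈ F, s(e.1, e.2) = x then φ h.choose else g x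
  have hfF : ∀ e ∈ F, f s(e.1, e.2) = φ e := by
    intro e he
    have h : ∃ e' ∈ F, s(e'.1, e'.2) = s(e.1, e.2) := ⟨e, he, rfl⟩
    simp only [f]
    rw [dif_pos h, huniq _ h.choose_spec.1 e he h.choose_spec.2]
  have hfH : ∀ x, (¬ ∃ e ∈ F, s(e.1, e.2) = x) → f x = g x := fun x h => dif_neg h
  have hmemH : ∀ x ∈ G.edgeSet, (¬ ∃ e ∈ F, s(e.1, e.2) = x) → x ∈ H.edgeSet := by
    intro x hx h
    rw [hH, SimpleGraph.edgeSet_deleteEdges]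
    exact ⟨hx, fun ⟨e, he, hex⟩ => h ⟨e, he, hex⟩⟩
  have hcross : ∀ e ∈ F, ∀ x ∈ G.edgeSet, (¬ ∃ e ∈ F, s(e.1, e.2) = x) →
      (∃ v, v ∈ s(e.1, e.2) ∧ v ∈ x) → f s(e.1, e.2) ≠ f x := by
    rintro e he x hx hxF ⟨v, hve, hvx⟩ heq
    have hxH := hmemH x hx hxF
    rw [hfF e he, hfH x hxF] at heq
    have hmem := Finset.mem_sdiff.1 (hφL e he)
    obtain ⟨w, rfl⟩ := hvx
    have hgN : g s(v, w) ∈ N v := Finset.mem_image_of_mem _ (by simpa using hxH)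
    refine hmem.2 ?_
    rw [heq, Finset.mem_union]
    rw [Sym2.mem_iff] at hve
    obtain rfl | rfl := hve
    · exact Or.inl hgN
    · exact Or.inr hgN
  refine ⟨f, fun x hx => ?_, fun x hx y hy hxy hadj => ?_⟩
  · by_cases hxF : ∃ e ∈ F, s(e.1, e.2) = x
    · obtain ⟨e, he, rfl⟩ := hxF
      rw [hfF e he]
      exact (Finset.mem_sdiff.1 (hφL e he)).1
    · rw [hfH x hxF]
      exact hg.1 x (hmemH x hx hxF)
  · by_cases hxF : ∃ e ∈ F, s(e.1, e.2) = x <;> by_cases hyF : ∃ e ∈ F, s(e.1, e.2) = y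
    · obtain ⟨e, he, rfl⟩ := hxF
      obtain ⟨e', he', rfl⟩ := hyF
      rw [hfF e he, hfF e' he']
      refine hφ e he e' he' (fun h => hxy (h ▸ rfl)) ?_
      obtain ⟨v, hv, hv'⟩ := hadj
      rw [Sym2.mem_iff] at hv hv'
      have h1 := hdisj e he e' he'
      have h2 := hdisj e' he' e he
      obtain rfl | rfl := hv <;> obtain h | h := hv'
      · exact Or.inl h
      · exact absurd h h1
      · exact absurd h.symm h2
      · exact Or.inr h
    · obtain ⟨e, he, rfl⟩ := hxF
      exact hcross e he y hy hyF hadj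
    · obtain ⟨e, he, rfl⟩ := hyF
      exact (hcross e he x hx hxF (by simpa [and_comm] using hadj)).symm
    · rw [hfH x hxF, hfH y hyF]
      exact hg.2 x (hmemH x hx hxF) y (hmemH y hy hyF) hxy hadj

/-- The charge still required by a vertex of degree `d` with `k` unpeeled edges. -/
def chargeNeed (d k : ℕ) : ℕ :=
  if d = 3 then 5 * (k - 1) else if d = 4 then 2 * (k - 2) else 0

/-- The charge still available at a vertex of degree `d` with `k` unpeeled edges. -/
def chargeCap (d k : ℕ) : ℕ :=
  if d = 5 then 2 * min k 1 else if d = 6 then (if k = 0 then 0 else if k = 1 then 5 else 7) else 0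

theorem chargeNeed_add_chargeCap_le {x y a b : ℕ} (h : 7 + min (a + 1) (b + 1) < x + y)
    (hx : x ≤ 4) (hy : 5 ≤ y) (hy' : y ≤ 6) (hxy : 9 ≤ x + y) :
    chargeNeed x (a + 1) + chargeCap y b ≤ chargeNeed x a + chargeCap y (b + 1) := by
  have hx' : x = 3 ∨ x = 4 := by omega
  have hy'' : y = 5 ∨ y = 6 := by omega
  unfold chargeNeed chargeCap
  obtain rfl | rfl := hx' <;> obtain rfl | rfl := hy'' <;> norm_num <;> (try split_ifs) <;> omega

theorem sum_add_eq_sum_add_of_eq_off {V : Type*} [Fintype V] {p q : V → ℕ} (u : V)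
    (h : ∀ v, v ≠ u → p v = q v) : ∑ v, p v + q u = ∑ v, q v + p u := by
  have h1 := Finset.add_sum_erase _ p (Finset.mem_univ u)
  have h2 := Finset.add_sum_erase _ q (Finset.mem_univ u)
  have h3 : ∑ v ∈ Finset.univ.erase u, p v = ∑ v ∈ Finset.univ.erase u, q v :=
    Finset.sum_congr rfl fun v hv => h v (Finset.ne_of_mem_erase hv)
  omega

theorem card_filter_erase {E : Type*} [DecidableEq E] (F : Finset E) (P : E → Prop)
    [DecidablePred P] {e : E} (he : e ∈ F)
    (hP : P e) : ((F.erase e).filter P).card + 1 = (F.filter P).card := by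
  rw [Finset.filter_erase, Finset.card_erase_add_one (Finset.mem_filter.2 ⟨he, hP⟩)]

theorem sum_chargeNeed_le_sum_chargeCap {V : Type*} [Fintype V] (d : V → ℕ) (F : Finset (V × V))
    (hd : ∀ e ∈ F, d e.1 ≤ 4 ∧ 5 ≤ d e.2 ∧ d e.2 ≤ 6 ∧ 9 ≤ d e.1 + d e.2)
    (hpeel : ∀ F' ⊆ F, F'.Nonempty → ∃ e ∈ F',
      7 + min (fiberCard Prod.fst F' e) (fiberCard Prod.snd F' e) < d e.1 + d e.2) :
    ∑ v, chargeNeed (d v) (F.filter (fun e => e.1 = v)).card ≤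
      ∑ v, chargeCap (d v) (F.filter (fun e => e.2 = v)).card := by
  induction F using Finset.strongInduction with
  | H F ih =>
  obtain rfl | hne := F.eq_empty_or_nonempty
  · simp [chargeNeed, chargeCap]
  obtain ⟨e, he, hlt⟩ := hpeel F (subset_refl F) hne
  have hsub := Finset.erase_subset e F
  have key := ih (F.erase e) (Finset.erase_ssubset he) (fun f hf => hd f (hsub hf))
    (fun F' hF' => hpeel F' (hF'.trans hsub))
  have h1 := sum_add_eq_sum_add_of_eq_off
    (p := fun v => chargeNeed (d v) (F.filter (fun e => e.1 = v)).card)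
    (q := fun v => chargeNeed (d v) ((F.erase e).filter (fun e => e.1 = v)).card) e.1 (by
      intro v hv
      simp only [Finset.filter_erase]
      rw [Finset.erase_eq_of_notMem]
      simp [hv.symm])
  have h2 := sum_add_eq_sum_add_of_eq_off
    (p := fun v => chargeCap (d v) (F.filter (fun e => e.2 = v)).card)
    (q := fun v => chargeCap (d v) ((F.erase e).filter (fun e => e.2 = v)).card) e.2 (by
      intro v hv
      simp only [Finset.filter_erase]
      rw [Finset.erase_eq_of_notMem]
      simp [hv.symm])
  have h3 := card_filter_erase F (fun f => f.1 = e.1) he rfl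
  have h4 := card_filter_erase F (fun f => f.2 = e.2) he rfl
  have h5 := hd e he
  simp only [fiberCard] at hlt h1 h2
  rw [← h3, ← h4] at hlt
  rw [← h3] at h1
  rw [← h4] at h2
  have := chargeNeed_add_chargeCap_le (by omega) h5.1 h5.2.1 h5.2.2.1 h5.2.2.2
  omega

/-- A graph of maximum degree at most `6` without a reducible bipartite set of edges has average
degree at least `14 / 3`, not counting isolated vertices. -/
theorem fourteen_mul_card_le_of_irreducible {V : Type*} [Fintype V] (G : SimpleGraph V)
    (h6 : ∀ v, (nbrs G v).card ≤ 6)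
    (hirr : ∀ F : Finset (V × V), F.Nonempty → (∀ e ∈ F, G.Adj e.1 e.2) →
      (∀ e ∈ F, ∀ f ∈ F, e.1 ≠ f.2) → ∃ e ∈ F,
        7 + min (fiberCard Prod.fst F e) (fiberCard Prod.snd F e) <
          (nbrs G e.1).card + (nbrs G e.2).card) :
    14 * (Finset.univ.filter (fun v => 0 < (nbrs G v).card)).card ≤
      3 * ∑ v ∈ Finset.univ.filter (fun v => 0 < (nbrs G v).card),
        (nbrs G v).card := by
  let d : V → ℕ := fun v => (nbrs G v).card
  change 14 * (Finset.univ.filter (fun v => 0 < d v)).card ≤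
    3 * ∑ v ∈ Finset.univ.filter (fun v => 0 < d v), d v
  have h9 : ∀ u v, G.Adj u v → 9 ≤ d u + d v := by
    intro u v huv
    obtain ⟨e, he, hlt⟩ := hirr {(u, v)} (by simp) (by simpa using huv) (by simpa using huv.ne)
    rw [Finset.mem_singleton] at he
    subst he
    have : 7 + min 1 1 < d u + d v := by simpa [fiberCard, Finset.filter_singleton] using hlt
    omega
  have h3 : ∀ v, 0 < d v → 3 ≤ d v := by
    intro v hv
    obtain ⟨w, hw⟩ := Finset.card_pos.1 hv
    have h1 := h9 v w (mem_nbrs.1 hw)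
    have h2 := h6 w
    change d w ≤ 6 at h2
    omega
  let F : Finset (V × V) := Finset.univ.filter (fun e => G.Adj e.1 e.2 ∧ d e.1 ≤ 4 ∧ 5 ≤ d e.2)
  have hF : ∀ {e}, e ∈ F ↔ G.Adj e.1 e.2 ∧ d e.1 ≤ 4 ∧ 5 ≤ d e.2 := by simp [F]
  have hsum := sum_chargeNeed_le_sum_chargeCap d F
    (fun e he => ⟨(hF.1 he).2.1, (hF.1 he).2.2, h6 e.2, h9 _ _ (hF.1 he).1⟩)
    (fun F' hF' hne => hirr F' hne (fun e he => (hF.1 (hF' he)).1) (fun e he f hf h => by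
      have h1 := (hF.1 (hF' he)).2.1
      have h2 := (hF.1 (hF' hf)).2.2
      rw [h] at h1
      omega))
  have hfull : ∀ v, d v ≤ 4 → (F.filter (fun e => e.1 = v)).card = d v := by
    intro v hv
    have : F.filter (fun e => e.1 = v) = (nbrs G v).image (fun w => (v, w)) := by
      ext ⟨a, b⟩
      simp only [Finset.mem_filter, hF, Finset.mem_image, mem_nbrs, Prod.mk.injEq]
      constructor
      · rintro ⟨⟨h, -, -⟩, rfl⟩
        exact ⟨b, h, rfl, rfl⟩
      · rintro ⟨w, h, rfl, rfl⟩
        have := h9 v w h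
        exact ⟨⟨h, hv, by omega⟩, rfl⟩
    rw [this, Finset.card_image_of_injective _ (Prod.mk_right_injective v)]
  have hpoint : ∀ v, chargeCap (d v) (F.filter (fun e => e.2 = v)).card +
      (if 0 < d v then 28 else 0) ≤
        chargeNeed (d v) (F.filter (fun e => e.1 = v)).card + if 0 < d v then 6 * d v else 0 := by
    intro v
    have h1 := h3 v
    have h2 : d v ≤ 6 := h6 v
    have h4 := hfull v
    generalize (F.filter (fun e => e.1 = v)).card = a at *
    generalize (F.filter (fun e => e.2 = v)).card = b at *
    generalize d v = x at *
    unfold chargeCap chargeNeed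
    split_ifs <;> omega
  have htot := Finset.sum_le_sum fun v (_ : v ∈ Finset.univ) => hpoint v
  rw [Finset.sum_add_distrib, Finset.sum_add_distrib, ← Finset.sum_filter, ← Finset.sum_filter,
    ← Finset.mul_sum, Finset.sum_const, smul_eq_mul] at htot
  omega

theorem MadLT.sum_card_lt {V : Type*} [Fintype V] {G H : SimpleGraph V} (hmad : MadLT G (14 / 3))
    (hHG : H ≤ G) (hne : H ≠ ⊥) :
    3 * ∑ v ∈ Finset.univ.filter (fun v => 0 < (nbrs H v).card),
        (nbrs H v).card <
      14 * (Finset.univ.filter (fun v => 0 < (nbrs H v).card)).card := by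
  have hpos : ∀ {u v}, H.Adj u v → 0 < (nbrs H u).card :=
    fun {u v} h => Finset.card_pos.2 ⟨v, by simpa using h⟩
  let K : G.Subgraph :=
    { verts := {v | 0 < (nbrs H v).card}
      Adj := H.Adj
      adj_sub := fun h => hHG h
      edge_vert := fun h => hpos h
      symm := H.symm }
  obtain ⟨u, v, huv⟩ := SimpleGraph.ne_bot_iff_exists_adj.1 hne
  have hK := hmad K ⟨u, hpos huv⟩
  have hverts : ∀ _ : Fintype K.verts, K.verts.toFinset =
      Finset.univ.filter (fun v => 0 < (nbrs H v).card) := by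
    intro _
    ext x
    simp [K]
  have hnb : ∀ v, (K.neighborSet v).ncard = (nbrs H v).card := by
    intro v
    rw [← Set.ncard_coe_finset]
    congr 1
    ext w
    simp [K]
  rw [hverts] at hK
  simp only [hnb] at hK
  have hc : (0 : ℝ) <
      ((Finset.univ.filter (fun v => 0 < (nbrs H v).card)).card : ℝ) := by
    exact_mod_cast Finset.card_pos.2 ⟨u, by
      rw [Finset.mem_filter]
      exact ⟨Finset.mem_univ _, hpos huv⟩⟩
  rw [div_lt_iff₀ hc] at hK
  have : (3 : ℝ) * ∑ v ∈ Finset.univ.filter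
        (fun v => 0 < (nbrs H v).card),
        ((nbrs H v).card : ℝ) <
      14 * ((Finset.univ.filter (fun v => 0 < (nbrs H v).card)).card : ℝ) := by
    linarith
  exact_mod_cast this

theorem MadLT.exists_coloring {V : Type*} [Fintype V] {G : SimpleGraph V}
    (h6 : ∀ v, (nbrs G v).card ≤ 6) (hmad : MadLT G (14 / 3))
    {L : Sym2 V → Finset ℕ} (hL : ∀ e ∈ G.edgeSet, 7 ≤ (L e).card) (H : SimpleGraph V)
    (hHG : H ≤ G) : ∃ f, IsProperListEdgeColoring H L f := by
  induction H using WellFoundedLT.induction with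
  | ind H ih =>
  by_cases hred : ∃ F : Finset (V × V), F.Nonempty ∧ (∀ e ∈ F, H.Adj e.1 e.2) ∧
      (∀ e ∈ F, ∀ f ∈ F, e.1 ≠ f.2) ∧ ∀ e ∈ F,
        (nbrs H e.1).card + (nbrs H e.2).card ≤
          7 + min (fiberCard Prod.fst F e) (fiberCard Prod.snd F e)
  · obtain ⟨F, ⟨e, he⟩, hF, hdisj, hdeg⟩ := hred
    have hle := H.deleteEdges_le ((fun e => s(e.1, e.2)) '' (F : Set (V × V)))
    obtain ⟨g, hg⟩ := ih (H.deleteEdges ((fun e => s(e.1, e.2)) '' (F : Set (V × V))))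
      (lt_of_le_of_ne hle fun h => by
        have hadj := hF e he
        rw [← h, SimpleGraph.deleteEdges_adj] at hadj
        exact hadj.2 ⟨e, he, rfl⟩)
      (hle.trans hHG)
    exact hg.exists_extension (fun x hx => hL x (SimpleGraph.edgeSet_mono hHG hx)) hF hdisj hdeg
  · by_cases hne : H = ⊥
    · subst hne
      exact ⟨fun _ => 0, by simp [IsProperListEdgeColoring]⟩
    · push Not at hred
      have h1 := fourteen_mul_card_le_of_irreducible H
        (fun v => (Finset.card_le_card fun w hw =>
          mem_nbrs.2 (hHG (mem_nbrs.1 hw))).trans (h6 v)) hred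
      have h2 := hmad.sum_card_lt hHG hne
      omega

theorem stmt_8 {V : Type*} [Fintype V] (G : SimpleGraph V) [DecidableRel G.Adj]
    (hΔ : G.maxDegree = 6) (hmad : MadLT G (14 / 3)) :
    listChromaticIndex G ≤ 7 := by
  have h6 : ∀ v, (nbrs G v).card ≤ 6 := by
    intro v
    have h := G.degree_le_maxDegree v
    rw [hΔ, ← SimpleGraph.card_neighborFinset_eq_degree] at h
    refine le_trans (Finset.card_le_card fun w hw => ?_) h
    simpa using hw
  exact Nat.sInf_le fun L hL => hmad.exists_coloring h6 hL G le_rfl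
end
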